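/- Let p > 3 be a prime with p ≡ 3 (mod 4), let ε be the Legendre symbol character modulo p, and let h be the class number of ℚ(√-p). Then the derivative of the Dirichlet L-function L(ε,s) at s = 0 equals Σ_{a=1}^{p-1} ε(a)·log Γ(a/p) - h·log p; equivalently, since L(ε,0) = h, the logarithmic derivative at s = 0 is (1/h)·Σ_{a=1}^{p-1} ε(a)·log Γ(a/p) - log p. -/

import Mathlib

section Lerch

open Complex Filter Topology Set

lemma norm_cpow_neg_sub_le {a b : ℝ} (ha : 0 < a) (hab : a ≤ b) (s : ℂ) (hs : -2 < s.re) :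
    ‖(a : ℂ) ^ (-s) - (b : ℂ) ^ (-s) + s * (a - b) * (b : ℂ) ^ (-s - 1)‖ ≤
      ‖s‖ * ‖s + 1‖ * a ^ (-(s.re + 2)) * (b - a) ^ 2 := by
  have key (r : ℂ) (t : ℝ) (ht : 0 < t) :
      HasDerivAt (fun y : ℝ ↦ (y : ℂ) ^ r) (r * (t : ℂ) ^ (r - 1)) t := by
    have h := (hasStrictDerivAt_id (t : ℂ)).cpow_const (c := r) (Or.inl (by simpa using ht))
    simpa using h.hasDerivAt.comp_ofReal
  have step1 (t : ℝ) (ht : t ∈ Icc a b) : ‖(b : ℂ) ^ (-s - 1) - (t : ℂ) ^ (-s - 1)‖ ≤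
      ‖s + 1‖ * a ^ (-(s.re + 2)) * (b - a) := by
    have := (convex_Icc a b).norm_image_sub_le_of_norm_hasDerivWithin_le
      (f := fun y : ℝ ↦ (y : ℂ) ^ (-s - 1)) (x := t) (y := b)
      (C := ‖s + 1‖ * a ^ (-(s.re + 2)))
      (fun y hy ↦ (key _ y (ha.trans_le hy.1)).hasDerivWithinAt)
      (fun y hy ↦ by
        have hy0 := ha.trans_le hy.1
        rw [norm_mul, show -s - 1 = -(s + 1) by ring, norm_neg,
          norm_cpow_eq_rpow_re_of_pos hy0]
        gcongr
        have : (-(s + 1) - 1).re = -(s.re + 2) := by simp; ring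
        rw [this]
        exact Real.rpow_le_rpow_of_nonpos ha hy.1 (by linarith))
      ht (right_mem_Icc.2 hab)
    refine this.trans ?_
    rw [Real.norm_of_nonneg (by linarith [ht.2])]
    gcongr
    exact ht.1
  have := (convex_Icc a b).norm_image_sub_le_of_norm_hasDerivWithin_le
      (f := fun y : ℝ ↦ (y : ℂ) ^ (-s) + s * y * (b : ℂ) ^ (-s - 1)) (x := b) (y := a)
      (f' := fun y : ℝ ↦ -s * (y : ℂ) ^ (-s - 1) + s * 1 * (b : ℂ) ^ (-s - 1))
      (C := ‖s‖ * (‖s + 1‖ * a ^ (-(s.re + 2)) * (b - a)))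
      (fun y hy ↦ ((key _ y (ha.trans_le hy.1)).add
        (((hasDerivAt_id (y : ℂ)).comp_ofReal.const_mul s).mul_const _)).hasDerivWithinAt)
      (fun y hy ↦ by
        rw [show -s * (y : ℂ) ^ (-s - 1) + s * 1 * (b : ℂ) ^ (-s - 1) =
          s * ((b : ℂ) ^ (-s - 1) - (y : ℂ) ^ (-s - 1)) by ring, norm_mul]
        gcongr
        exact step1 y hy)
      (right_mem_Icc.2 hab) (left_mem_Icc.2 hab)
  rw [Real.norm_of_nonpos (by linarith : a - b ≤ 0)] at this
  calc _ = ‖(a : ℂ) ^ (-s) + s * a * (b : ℂ) ^ (-s - 1) -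
        ((b : ℂ) ^ (-s) + s * b * (b : ℂ) ^ (-s - 1))‖ := by congr 1; ring
    _ ≤ _ := this
    _ = _ := by ring

noncomputable def lerchTerm (x : ℝ) (n : ℕ) (s : ℂ) : ℂ :=
  ((n + x : ℝ) : ℂ) ^ (-s) - ((n + 1 : ℝ) : ℂ) ^ (-s)
    + s * ((n + x : ℝ) - (n + 1 : ℝ)) * ((n + 1 : ℝ) : ℂ) ^ (-s - 1)

def lerchDomain : Set ℂ := {s | -1 / 2 < s.re} ∩ Metric.ball 0 3

lemma isOpen_lerchDomain : IsOpen lerchDomain :=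
  (isOpen_lt continuous_const continuous_re).inter Metric.isOpen_ball

lemma isPreconnected_lerchDomain : IsPreconnected lerchDomain :=
  ((convex_halfSpace_re_gt _).inter (convex_ball _ _)).isPreconnected

lemma differentiable_lerchTerm {x : ℝ} (hx : 0 < x) (n : ℕ) : Differentiable ℂ (lerchTerm x n) := by
  have h1 : ((n + x : ℝ) : ℂ) ≠ 0 := ofReal_ne_zero.2 (by positivity)
  have h2 : ((n + 1 : ℝ) : ℂ) ≠ 0 := ofReal_ne_zero.2 (by positivity)
  have aux {c : ℂ} (hc : c ≠ 0) {f : ℂ → ℂ} (hf : Differentiable ℂ f) :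
    Differentiable ℂ (fun s ↦ c ^ f s) := fun s ↦ (hf s).const_cpow (Or.inl hc)
  unfold lerchTerm
  exact ((aux h1 (by fun_prop)).sub (aux h2 (by fun_prop))).add
    ((by fun_prop : Differentiable ℂ fun s : ℂ ↦ s * (((n + x : ℝ) : ℂ) - ((n + 1 : ℝ) : ℂ))).mul
    (aux h2 (by fun_prop)))

lemma norm_lerchTerm_le {x : ℝ} (hx : 0 < x) (hx1 : x ≤ 1) (n : ℕ) {s : ℂ}
    (hs : s ∈ lerchDomain) :
    ‖lerchTerm x n s‖ ≤ 12 * x ^ (-5 : ℝ) * ((n + 1 : ℕ) : ℝ) ^ (-(3 / 2) : ℝ) := by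
  obtain ⟨hs1, hs2⟩ := hs
  rw [mem_ofPred_eq] at hs1
  rw [mem_ball_zero_iff] at hs2
  have hre : s.re < 3 := (re_le_norm s).trans_lt hs2
  have hsn : ‖s + 1‖ ≤ 4 := (norm_add_le _ _).trans (by rw [norm_one]; linarith)
  refine (norm_cpow_neg_sub_le (a := n + x) (b := n + 1) (by positivity) (by linarith) s
    (by linarith)).trans ?_
  have e : ((n : ℝ) + 1 - (n + x)) ^ 2 ≤ 1 := by nlinarith
  have h12 : ‖s‖ * ‖s + 1‖ ≤ 12 := by nlinarith [norm_nonneg s, norm_nonneg (s + 1)]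
  have hpow : ((n : ℝ) + x) ^ (-(s.re + 2)) ≤
      x ^ (-5 : ℝ) * ((n + 1 : ℕ) : ℝ) ^ (-(3 / 2) : ℝ) := by
    calc ((n : ℝ) + x) ^ (-(s.re + 2)) ≤ (x * (n + 1)) ^ (-(s.re + 2)) :=
          Real.rpow_le_rpow_of_nonpos (by positivity)
            (by nlinarith [(Nat.cast_nonneg n : (0 : ℝ) ≤ n)]) (by linarith)
      _ = x ^ (-(s.re + 2)) * (n + 1 : ℝ) ^ (-(s.re + 2)) :=
          Real.mul_rpow hx.le (by positivity)
      _ ≤ _ := by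
        push_cast
        gcongr ?_ * ?_
        · exact Real.rpow_le_rpow_of_exponent_ge hx hx1 (by linarith)
        · exact Real.rpow_le_rpow_of_exponent_le (by linarith [(Nat.cast_nonneg n : (0 : ℝ) ≤ n)])
            (by linarith)
  calc _ ≤ 12 * (x ^ (-5 : ℝ) * ((n + 1 : ℕ) : ℝ) ^ (-(3 / 2) : ℝ)) * 1 := by
        gcongr
    _ = _ := by ring

lemma summable_lerch_bound (x : ℝ) :
    Summable fun n : ℕ ↦ 12 * x ^ (-5 : ℝ) * ((n + 1 : ℕ) : ℝ) ^ (-(3 / 2) : ℝ) :=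
  ((summable_nat_add_iff (f := fun n : ℕ ↦ (n : ℝ) ^ (-(3 / 2) : ℝ)) 1).2
    (Real.summable_nat_rpow.2 (by norm_num))).mul_left _

/-- The entire function `s ↦ (s - 1) ζ(s)`. -/
noncomputable def zetaMulSubOne : ℂ → ℂ :=
  Function.update (fun s ↦ (s - 1) * riemannZeta s) 1 1

lemma zetaMulSubOne_eq : zetaMulSubOne = DirichletCharacter.LFunctionTrivChar₁ 1 := by
  have : (fun s ↦ (s - 1) * riemannZeta s) =
      fun s ↦ (s - 1) * DirichletCharacter.LFunctionTrivChar 1 s := by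
    ext s
    rw [DirichletCharacter.LFunctionTrivChar, DirichletCharacter.LFunction_modOne_eq]
  simp [zetaMulSubOne, DirichletCharacter.LFunctionTrivChar₁, this]

lemma differentiable_zetaMulSubOne : Differentiable ℂ zetaMulSubOne :=
  zetaMulSubOne_eq ▸ DirichletCharacter.differentiable_LFunctionTrivChar₁ 1

lemma hasDerivAt_zetaMulSubOne :
    HasDerivAt zetaMulSubOne Real.eulerMascheroniConstant 1 := by
  rw [hasDerivAt_iff_tendsto_slope]
  refine tendsto_riemannZeta_sub_one_div.congr' ?_
  filter_upwards [self_mem_nhdsWithin] with s hs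
  have hs' : s - 1 ≠ 0 := sub_ne_zero.2 hs
  rw [slope_def_field, zetaMulSubOne, Function.update_of_ne hs, Function.update_self]
  field_simp

lemma hurwitzZeta_sub_riemannZeta_eq {x : ℝ} (hx : 0 < x) (hx1 : x ≤ 1) {s : ℂ}
    (hs : s ∈ lerchDomain) :
    HurwitzZeta.hurwitzZeta (x : UnitAddCircle) s - HurwitzZeta.hurwitzZeta 0 s =
      (∑' n, lerchTerm x n s) - (x - 1) * zetaMulSubOne (s + 1) := by
  have hF : AnalyticOnNhd ℂ (fun s ↦ HurwitzZeta.hurwitzZeta (x : UnitAddCircle) s -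
      HurwitzZeta.hurwitzZeta 0 s) lerchDomain :=
    (HurwitzZeta.differentiable_hurwitzZeta_sub_hurwitzZeta _ _).differentiableOn.analyticOnNhd
      isOpen_lerchDomain
  have hG : AnalyticOnNhd ℂ (fun s ↦ (∑' n, lerchTerm x n s) - (x - 1) * zetaMulSubOne (s + 1))
      lerchDomain := by
    refine DifferentiableOn.analyticOnNhd (.sub ?_ ?_) isOpen_lerchDomain
    · exact differentiableOn_tsum_of_summable_norm (summable_lerch_bound x)
        (fun n ↦ (differentiable_lerchTerm hx n).differentiableOn) isOpen_lerchDomain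
        (fun n w hw ↦ norm_lerchTerm_le hx hx1 n hw)
    · exact (Differentiable.const_mul (differentiable_zetaMulSubOne.comp (by fun_prop)) _).differentiableOn
  have h2 : (2 : ℂ) ∈ lerchDomain := by
    constructor
    · norm_num
    · rw [mem_ball_zero_iff]; norm_num
  refine hF.eqOn_of_preconnected_of_eventuallyEq hG isPreconnected_lerchDomain h2 ?_ hs
  filter_upwards [(isOpen_lt continuous_const continuous_re).mem_nhds
    (by norm_num : (1 : ℝ) < (2 : ℂ).re)] with s (hs : 1 < s.re)
  have hs0 : s ≠ 0 := by rintro rfl; norm_num at hs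
  have A := HurwitzZeta.hasSum_hurwitzZeta_of_one_lt_re ⟨hx.le, hx1⟩ hs
  have B := HurwitzZeta.hasSum_hurwitzZeta_of_one_lt_re (a := 1) (by simp) hs
  have C := HurwitzZeta.hasSum_hurwitzZeta_of_one_lt_re (a := 1) (s := s + 1) (by simp)
    (by simp; linarith)
  have e : ((1 : ℝ) : UnitAddCircle) = 0 := AddCircle.coe_period 1
  rw [e] at B C
  rw [zetaMulSubOne, Function.update_of_ne (by simpa using hs0), ← HurwitzZeta.hurwitzZeta_zero]
  have := (A.sub B).add (C.mul_left (s * (x - 1)))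
  rw [eq_sub_iff_add_eq, add_sub_cancel_right]
  refine (Eq.trans ?_ this.tsum_eq.symm).trans ?_
  · ring
  refine tsum_congr fun n ↦ ?_
  rw [lerchTerm, show -s - 1 = -(s + 1) by ring, cpow_neg, cpow_neg, cpow_neg]
  push_cast
  ring

lemma deriv_lerchTerm_zero {x : ℝ} (hx : 0 < x) (n : ℕ) :
    deriv (lerchTerm x n) 0 =
      ((-Real.log (x + n) + Real.log (n + 1) + (x - 1) * (n + 1 : ℝ)⁻¹ : ℝ) : ℂ) := by
  have p1 : (0 : ℝ) < n + x := by positivity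
  have p2 : (0 : ℝ) < n + 1 := by positivity
  have h1 : ((n + x : ℝ) : ℂ) ≠ 0 := ofReal_ne_zero.2 p1.ne'
  have h2 : ((n + 1 : ℝ) : ℂ) ≠ 0 := ofReal_ne_zero.2 p2.ne'
  have d1 := (hasDerivAt_id (0 : ℂ)).neg.const_cpow (c := ((n + x : ℝ) : ℂ)) (Or.inl h1)
  have d2 := (hasDerivAt_id (0 : ℂ)).neg.const_cpow (c := ((n + 1 : ℝ) : ℂ)) (Or.inl h2)
  have d3 := ((hasDerivAt_id (0 : ℂ)).neg.sub_const 1).const_cpow (c := ((n + 1 : ℝ) : ℂ))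
    (Or.inl h2)
  have d4 := ((hasDerivAt_id (0 : ℂ)).mul_const (((n + x : ℝ) : ℂ) - ((n + 1 : ℝ) : ℂ))).mul d3
  have d := ((d1.sub d2).add d4).deriv
  refine Eq.trans ?_ (d.trans ?_)
  · rfl
  · simp only [Pi.neg_apply, id, neg_zero, cpow_zero, zero_sub, zero_mul, cpow_neg_one]
    rw [← ofReal_log p1.le, ← ofReal_log p2.le, add_comm x]
    push_cast
    ring

/-- **Lerch's formula**, relative to the Riemann zeta function. -/
theorem hasDerivAt_hurwitzZeta_sub_zero {x : ℝ} (hx : 0 < x) (hx1 : x ≤ 1) :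
    HasDerivAt (fun s ↦ HurwitzZeta.hurwitzZeta (x : UnitAddCircle) s -
      HurwitzZeta.hurwitzZeta 0 s) (Real.log (Real.Gamma x) : ℂ) 0 := by
  have h0 : (0 : ℂ) ∈ lerchDomain := ⟨by norm_num, by simp⟩
  have hD := differentiableOn_tsum_of_summable_norm (summable_lerch_bound x)
        (fun n ↦ (differentiable_lerchTerm hx n).differentiableOn) isOpen_lerchDomain
        (fun n w hw ↦ norm_lerchTerm_le hx hx1 n hw)
  have hS := hasSum_deriv_of_summable_norm (summable_lerch_bound x)
        (fun n ↦ (differentiable_lerchTerm hx n).differentiableOn) isOpen_lerchDomain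
        (fun n w hw ↦ norm_lerchTerm_le hx hx1 n hw) h0
  have hval : deriv (fun w ↦ ∑' n, lerchTerm x n w) 0 =
      (Real.log (Real.Gamma x) + (x - 1) * Real.eulerMascheroniConstant : ℝ) := by
    refine tendsto_nhds_unique (hS.tendsto_sum_nat.comp (tendsto_add_atTop_nat 1)) ?_
    have T1 := Real.BohrMollerup.tendsto_log_gamma hx
    have T2 := Real.tendsto_harmonic_sub_log.comp (tendsto_add_atTop_nat 1)
    have T3 : Tendsto (fun n : ℕ ↦ Real.log ((n : ℝ) + 1) - Real.log n) atTop (𝓝 0) :=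
      (Real.tendsto_log_comp_add_sub_log 1).comp tendsto_natCast_atTop_atTop
    have T := (T1.add (T2.const_mul (x - 1))).add (T3.const_mul x)
    rw [mul_zero, add_zero] at T
    refine (((continuous_ofReal.tendsto _).comp T)).congr fun n ↦ ?_
    simp only [Function.comp_apply, deriv_lerchTerm_zero hx]
    rw [← ofReal_sum]
    congr 1
    rw [Finset.sum_add_distrib, Finset.sum_add_distrib, ← Finset.mul_sum, harmonic,
      Real.BohrMollerup.logGammaSeq, Finset.sum_neg_distrib]
    have : ∀ m : ℕ, Real.log (m.factorial) = ∑ k ∈ Finset.range m, Real.log ((k : ℝ) + 1) := by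
      intro m
      induction m with
      | zero => simp
      | succ k ih =>
        rw [Finset.sum_range_succ, ← ih, Nat.factorial_succ]
        push_cast
        rw [Real.log_mul (by positivity) (by positivity)]
        ring
    rw [this, Finset.sum_range_succ (fun k : ℕ ↦ Real.log ((k : ℝ) + 1))]
    push_cast
    ring
  have hE : HasDerivAt (fun s ↦ (∑' n, lerchTerm x n s) - (x - 1) * zetaMulSubOne (s + 1))
      (Real.log (Real.Gamma x) : ℂ) 0 := by
    have a := (hD.differentiableAt (isOpen_lerchDomain.mem_nhds h0)).hasDerivAt
    have b : HasDerivAt (fun s : ℂ ↦ zetaMulSubOne (s + 1)) Real.eulerMascheroniConstant 0 := by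
      refine HasDerivAt.comp_add_const (x := (0 : ℂ)) (a := 1) ?_
      simpa using hasDerivAt_zetaMulSubOne
    convert! a.sub (b.const_mul ((x : ℂ) - 1)) using 1
    rw [hval]
    push_cast
    ring
  refine hE.congr_of_eventuallyEq ?_
  filter_upwards [isOpen_lerchDomain.mem_nhds h0] with s hs
  exact hurwitzZeta_sub_riemannZeta_eq hx hx1 hs

end Lerch

section GaussSign

open Complex Filter Topology Set

lemma tendsto_jacobiTheta₂_of_tendsto_im {ι : Type*} {l : Filter ι} {τ : ι → ℂ}
    (hτ : Tendsto (fun i ↦ (τ i).im) l atTop) (z : ℝ) :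
    Tendsto (fun i ↦ jacobiTheta₂ z (τ i)) l (𝓝 1) := by
  have hsum : Summable fun n : ℤ ↦ ‖jacobiTheta₂_term n z I‖ :=
    ((summable_jacobiTheta₂_term_iff _ _).2 (by simp)).norm
  have key : ∀ n : ℤ, Tendsto (fun i ↦ jacobiTheta₂_term n z (τ i)) l
      (𝓝 (if n = 0 then 1 else 0)) := by
    intro n
    split_ifs with hn
    · simpa [jacobiTheta₂_term, hn] using tendsto_const_nhds
    · rw [tendsto_zero_iff_norm_tendsto_zero]
      simp only [norm_jacobiTheta₂_term, ofReal_im, mul_zero, sub_zero]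
      refine Real.tendsto_exp_atBot.comp ?_
      have : -Real.pi * (n : ℝ) ^ 2 < 0 := by
        have := Real.pi_pos
        have : 0 < (n : ℝ) ^ 2 := by positivity
        nlinarith
      exact hτ.const_mul_atTop_of_neg this
  have := tendsto_tsum_of_dominated_convergence hsum key (by
    filter_upwards [hτ.eventually_ge_atTop 1] with i hi n
    rw [norm_jacobiTheta₂_term, norm_jacobiTheta₂_term]
    simp only [ofReal_im, mul_zero, sub_zero, I_im, mul_one]
    have : 0 ≤ Real.pi * (n : ℝ) ^ 2 := by positivity
    exact Real.exp_le_exp.2 (by nlinarith))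
  simpa [jacobiTheta₂, tsum_ite_eq] using this

lemma jacobiTheta₂_zero_eq_sum_residues (N : ℕ) [NeZero N] (x : ℝ)
    (hx : ∀ n m : ℤ, cexp (Real.pi * I * (n + N * m) ^ 2 * x) = cexp (Real.pi * I * n ^ 2 * x))
    {t : ℂ} (ht : 0 < t.re) :
    jacobiTheta₂ 0 (x + I * t) = ∑ a : Fin N, cexp (Real.pi * I * (a : ℂ) ^ 2 * x) *
      (1 / (t * N ^ 2) ^ (1 / 2 : ℂ) *
        jacobiTheta₂ (((a : ℝ) / N : ℝ) : ℂ) (I / (t * N ^ 2))) := by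
  have ht0 : t ≠ 0 := by rintro rfl; simp at ht
  have hN : (N : ℂ) ≠ 0 := Nat.cast_ne_zero.2 (NeZero.ne N)
  have h1 := hasSum_jacobiTheta₂_term 0 (τ := x + I * t) (by simpa using ht)
  have h2 := ((Int.divModEquiv N).symm.hasSum_iff.2 h1).prod_fiberwise (fun m ↦ hasSum_fintype _)
  have him : 0 < (I * t * N ^ 2).im := by
    have hN' : (0 : ℝ) < N ^ 2 := by have := NeZero.pos N; positivity
    rw [show (I * t * N ^ 2) = ((N ^ 2 : ℝ) : ℂ) * (I * t) by push_cast; ring, im_ofReal_mul]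
    simpa using mul_pos hN' ht
  have h3 (a : Fin N) := (hasSum_jacobiTheta₂_term (I * t * a * N) him).mul_left
    (cexp (Real.pi * I * (a : ℂ) ^ 2 * x) * cexp (-Real.pi * t * a ^ 2))
  have h4 := hasSum_sum (fun a (_ : a ∈ Finset.univ) ↦ h3 a)
  refine (h2.unique (h4.congr_fun fun m ↦ ?_)).trans ?_
  · refine Finset.sum_congr rfl fun a _ ↦ ?_
    have := hx a m
    simp only [Function.comp_apply, Int.divModEquiv_symm_apply, jacobiTheta₂_term]
    push_cast at this ⊢
    rw [mul_zero, zero_add, show (Real.pi * I * (m * N + a) ^ 2 * (x + I * t) : ℂ) =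
      Real.pi * I * (a + N * m) ^ 2 * x + Real.pi * I * (a + N * m) ^ 2 * (I * t) by ring,
      exp_add, this, mul_assoc (cexp _) (cexp _) (cexp _), ← exp_add (-Real.pi * t * a ^ 2)]
    congr 2
    linear_combination (Real.pi * t * a ^ 2 : ℂ) * I_sq
  · refine Finset.sum_congr rfl fun a _ ↦ ?_
    rw [jacobiTheta₂_functional_equation, mul_assoc]
    congr 1
    rw [mul_left_comm, ← mul_assoc, ← mul_assoc, mul_assoc (1 / _) (cexp _) (cexp _), ← exp_add]
    congr 1
    · rw [show -I * (I * t) * N ^ 2 = t * N ^ 2 by linear_combination (-t * N ^ 2) * I_sq]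
      have : -Real.pi * I * (I * t * a * N) ^ 2 / (I * t * N ^ 2) + -Real.pi * t * (a : ℂ) ^ 2 = 0 := by
        have : I ^ 2 = -1 := I_sq
        field_simp
        rw [this]; ring
      rw [this, exp_zero, mul_one]
    · congr 1
      · push_cast
        field_simp
      · have : I ^ 2 = -1 := I_sq
        field_simp
        rw [this]

lemma ofReal_mul_cpow {r : ℝ} (hr : 0 < r) {w : ℂ} (hw : w ≠ 0) (z : ℂ) :
    (r * w) ^ z = (r : ℂ) ^ z * w ^ z := by
  have hr' : (r : ℂ) ≠ 0 := ofReal_ne_zero.2 hr.ne'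
  rw [cpow_def_of_ne_zero (mul_ne_zero hr' hw), cpow_def_of_ne_zero hr', cpow_def_of_ne_zero hw,
    log_ofReal_mul hr hw, ← exp_add, ofReal_log hr.le]
  ring_nf

/-- The quadratic exponential sum over residues, evaluated through the asymptotics of the
Jacobi theta function at two cusps. -/
lemma sum_exp_sq_eq (p : ℕ) [NeZero p] :
    ∑ a : Fin p, cexp (Real.pi * I * (a : ℂ) ^ 2 * (2 / p : ℝ)) =
      (1 + cexp (Real.pi * I * (-p / 2))) / (-2 * I / p) ^ (1 / 2 : ℂ) := by
  have hp : (0 : ℝ) < p := Nat.cast_pos.2 (NeZero.pos p)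
  have hpc : (p : ℂ) ≠ 0 := Nat.cast_ne_zero.2 (NeZero.ne p)
  have hper1 (n m : ℤ) : cexp (Real.pi * I * (n + p * m) ^ 2 * (2 / p : ℝ)) =
      cexp (Real.pi * I * n ^ 2 * (2 / p : ℝ)) := by
    rw [exp_eq_exp_iff_exists_int]
    refine ⟨2 * n * m + p * m ^ 2, ?_⟩
    push_cast
    field_simp
    ring
  have hper2 (n m : ℤ) : cexp (Real.pi * I * (n + (2 : ℕ) * m) ^ 2 * (-p / 2 : ℝ)) =
      cexp (Real.pi * I * n ^ 2 * (-p / 2 : ℝ)) := by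
    rw [exp_eq_exp_iff_exists_int]
    refine ⟨-(p * (n * m + m ^ 2)), ?_⟩
    push_cast
    field_simp
    ring
  let u : ℝ → ℂ := fun δ ↦ p / 2 - I * δ
  have hu (δ : ℝ) : u δ ≠ 0 := fun h ↦ by
    have := congrArg re h
    simp [u] at this
    exact hpc (by exact_mod_cast this)
  let w : ℝ → ℂ := fun δ ↦ 2 * p / u δ
  have hw (δ : ℝ) : w δ ≠ 0 := div_ne_zero (by simpa using hpc) (hu δ)
  have hw_im {δ : ℝ} (hδ : 0 < δ) : (I / (δ * w δ)).im = 1 / (4 * δ) := by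
    have : I / (δ * w δ) = ((1 / (2 * p) : ℝ) : ℂ) + I * ((1 / (4 * δ) : ℝ) : ℂ) := by
      have hδ' : (δ : ℂ) ≠ 0 := ofReal_ne_zero.2 hδ.ne'
      have := hu δ
      simp only [w]
      push_cast
      field_simp
      simp only [u]
      linear_combination (-4 * δ : ℂ) * I_sq
    rw [this]
    simp
  have hu_cont : Continuous u := by fun_prop
  have hw_cont : Continuous w := continuous_const.div hu_cont hu
  have main (δ : ℝ) (hδ : 0 < δ) :
      ∑ a : Fin p, cexp (Real.pi * I * (a : ℂ) ^ 2 * (2 / p : ℝ)) *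
        (1 / (w δ) ^ (1 / 2 : ℂ) * jacobiTheta₂ (((a : ℝ) / p : ℝ) : ℂ) (I / (δ * w δ))) =
      1 / (-I / u δ) ^ (1 / 2 : ℂ) *
        ∑ a : Fin 2, cexp (Real.pi * I * (a : ℂ) ^ 2 * (-p / 2 : ℝ)) *
        (1 / (4 : ℂ) ^ (1 / 2 : ℂ) *
          jacobiTheta₂ (((a : ℝ) / (2 : ℕ) : ℝ) : ℂ) (I / (δ * 4))) := by
    have hδ' : (δ : ℂ) ≠ 0 := ofReal_ne_zero.2 hδ.ne'
    have e1 : 1 / u δ = (2 / p : ℝ) + I * (δ * w δ / p ^ 2) := by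
      have := hu δ
      simp only [w]
      push_cast
      field_simp
      simp only [u]
      ring
    have e2 : -1 / (1 / u δ) = (-p / 2 : ℝ) + I * δ := by
      have := hu δ
      push_cast
      field_simp
      simp only [u]
      ring
    have r1 : 0 < (δ * w δ / p ^ 2 : ℂ).re := by
      have : 0 < (1 / (δ * w δ / p ^ 2 : ℂ)).re := by
        have e : (1 / (δ * w δ / p ^ 2 : ℂ)) = ((p ^ 2 : ℝ) : ℂ) * (-I * (I / (δ * w δ))) := by
          have := hw δ
          push_cast
          field_simp
          simp
        have := hw_im hδ
        rw [e, re_ofReal_mul, neg_mul, neg_re, I_mul_re, this]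
        simp only [neg_neg]
        positivity
      rw [one_div, inv_re] at this
      by_contra hcon
      exact absurd this (not_lt.2 (div_nonpos_of_nonpos_of_nonneg (not_lt.1 hcon)
        (normSq_nonneg _)))
    have A := jacobiTheta₂_zero_eq_sum_residues p (2 / p) hper1 r1
    have B := jacobiTheta₂_zero_eq_sum_residues 2 (-p / 2) hper2 (t := δ) (by simpa using hδ)
    rw [← e1, jacobiTheta₂_functional_equation, e2, zero_div, B] at A
    rw [show (0 : ℂ) ^ 2 = 0 by simp, mul_zero, zero_div, exp_zero, mul_one, mul_one_div] at A
    have c1 : (δ * w δ / p ^ 2 * p ^ 2 : ℂ) = δ * w δ := by field_simp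
    have c2 : (δ * ((2 : ℕ) : ℂ) ^ 2) = δ * 4 := by norm_num
    rw [c1, c2, ofReal_mul_cpow hδ (hw δ), ofReal_mul_cpow hδ (by norm_num)] at A
    have hδ2 : (δ : ℂ) ^ (1 / 2 : ℂ) ≠ 0 := by simp [cpow_eq_zero_iff, hδ']
    have := congrArg (fun z ↦ (δ : ℂ) ^ (1 / 2 : ℂ) * z) A.symm
    simp only [Finset.mul_sum] at this ⊢
    convert! this using 1
    · refine Finset.sum_congr rfl fun a _ ↦ ?_
      field_simp
    · refine Finset.sum_congr rfl fun a _ ↦ ?_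
      field_simp
  have lim0 : Tendsto (fun δ : ℝ ↦ δ) (𝓝[>] 0) (𝓝 0) := tendsto_nhdsWithin_of_tendsto_nhds tendsto_id
  have limIm : Tendsto (fun δ : ℝ ↦ 1 / (4 * δ)) (𝓝[>] 0) atTop := by
    have := (tendsto_inv_nhdsGT_zero (𝕜 := ℝ)).const_mul_atTop (by norm_num : (0 : ℝ) < 1 / 4)
    refine this.congr fun δ ↦ ?_
    rw [one_div_mul_eq_div, one_div, mul_inv, div_eq_inv_mul]
  have T1 (z : ℝ) : Tendsto (fun δ : ℝ ↦ jacobiTheta₂ z (I / (δ * w δ))) (𝓝[>] 0) (𝓝 1) := by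
    refine tendsto_jacobiTheta₂_of_tendsto_im (limIm.congr' ?_) z
    filter_upwards [self_mem_nhdsWithin] with δ hδ using (hw_im hδ).symm
  have T2 (z : ℝ) : Tendsto (fun δ : ℝ ↦ jacobiTheta₂ z (I / (δ * 4))) (𝓝[>] 0) (𝓝 1) := by
    refine tendsto_jacobiTheta₂_of_tendsto_im (limIm.congr fun δ ↦ ?_) z
    rw [show I / (δ * 4 : ℂ) = ((1 / (4 * δ) : ℝ) : ℂ) * I by push_cast; ring]
    simp
  have hw0 : w 0 = 4 := by simp only [w, u]; field_simp; simp; norm_num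
  have hu0 : -I / u 0 = -2 * I / p := by simp only [u]; field_simp; simp
  have T3 : Tendsto (fun δ ↦ (w δ) ^ (1 / 2 : ℂ)) (𝓝[>] 0) (𝓝 (4 ^ (1 / 2 : ℂ))) := by
    rw [← hw0]
    refine ((hw_cont.tendsto 0).mono_left nhdsWithin_le_nhds).cpow tendsto_const_nhds ?_
    rw [hw0]; simp [slitPlane]
  have T4 : Tendsto (fun δ ↦ (-I / u δ) ^ (1 / 2 : ℂ)) (𝓝[>] 0)
      (𝓝 ((-2 * I / p) ^ (1 / 2 : ℂ))) := by
    rw [← hu0]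
    refine (((continuous_const.div hu_cont hu).tendsto 0).mono_left nhdsWithin_le_nhds).cpow
      tendsto_const_nhds ?_
    rw [Pi.div_apply, hu0]
    right
    rw [show (-2 * I / p : ℂ) = ((-2 / p : ℝ) : ℂ) * I by push_cast; ring]
    simp
    exact NeZero.ne p
  have h4 : (4 : ℂ) ^ (1 / 2 : ℂ) ≠ 0 := by simp [cpow_eq_zero_iff]
  have h5 : (-2 * I / p : ℂ) ^ (1 / 2 : ℂ) ≠ 0 := by simp [cpow_eq_zero_iff, hpc]
  have L1 := tendsto_finsetSum Finset.univ (fun (a : Fin p) _ ↦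
    ((tendsto_const_nhds (x := (1 : ℂ)).div T3 h4).mul (T1 ((a : ℝ) / p))).const_mul
      (cexp (Real.pi * I * (a : ℂ) ^ 2 * (2 / p : ℝ))))
  have L2 := (tendsto_const_nhds (x := (1 : ℂ)).div T4 h5).mul
    (tendsto_finsetSum Finset.univ (fun (a : Fin 2) _ ↦
    ((tendsto_const_nhds (x := 1 / (4 : ℂ) ^ (1 / 2 : ℂ))).mul (T2 ((a : ℝ) / (2 : ℕ)))).const_mul
      (cexp (Real.pi * I * (a : ℂ) ^ 2 * (-p / 2 : ℝ)))))
  have := tendsto_nhds_unique_of_eventuallyEq L1 L2 (by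
    filter_upwards [self_mem_nhdsWithin] with δ hδ using main δ hδ)
  simp only [mul_one, ← Finset.sum_mul] at this
  rw [← mul_assoc] at this
  have := mul_right_cancel₀ (div_ne_zero one_ne_zero h4) this
  rw [this]
  simp [Fin.sum_univ_two]
  ring

lemma sum_exp_sq_eq_of_mod_four (p : ℕ) [NeZero p] (hp : p % 4 = 3) :
    ∑ a : Fin p, cexp (Real.pi * I * (a : ℂ) ^ 2 * (2 / p : ℝ)) = I * (√p : ℝ) := by
  have hpos : (0 : ℝ) < p := Nat.cast_pos.2 (NeZero.pos p)
  have hs : (0 : ℝ) < √p := Real.sqrt_pos.2 hpos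
  have hs' : ((√p : ℝ) : ℂ) ≠ 0 := ofReal_ne_zero.2 hs.ne'
  have hsq : ((√p : ℝ) : ℂ) ^ 2 = p := by
    rw [← ofReal_pow, Real.sq_sqrt hpos.le]; simp
  have h1 : cexp (Real.pi * I * (-p / 2)) = I := by
    obtain ⟨k, hk⟩ : ∃ k : ℕ, p = 4 * k + 3 := ⟨p / 4, by omega⟩
    refine Eq.trans ?_ exp_pi_div_two_mul_I
    rw [exp_eq_exp_iff_exists_int]
    refine ⟨-k - 1, ?_⟩
    rw [hk]
    push_cast
    ring
  have h2 : (-2 * I / p : ℂ) ^ (1 / 2 : ℂ) = (1 - I) / (√p : ℝ) := by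
    rw [one_div, ← sq_cpow_two_inv (x := (1 - I) / (√p : ℝ)) (by
      rw [div_ofReal_re]; simpa using hpos), div_pow, hsq]
    congr 2
    linear_combination -I_sq
  rw [sum_exp_sq_eq, h1, h2]
  have : (1 - I) ≠ 0 := fun h ↦ by simpa using congrArg re h
  field_simp
  linear_combination I_sq

lemma gaussSum_quadraticChar_eq (p : ℕ) [Fact p.Prime] (hp : p % 4 = 3) :
    gaussSum ((quadraticChar (ZMod p)).ringHomComp (Int.castRingHom ℂ)) ZMod.stdAddChar =
      I * (√p : ℝ) := by
  rw [← sum_exp_sq_eq_of_mod_four p hp]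
  have hp2 : ringChar (ZMod p) ≠ 2 := by rw [ZMod.ringChar_zmod_n]; omega
  have h0 : ∑ b : ZMod p, ZMod.stdAddChar b = 0 := by
    refine AddChar.sum_eq_zero_of_ne_one ?_
    have := ZMod.isPrimitive_stdAddChar p (a := 1) one_ne_zero
    rwa [AddChar.mulShift_one] at this
  have h1 : ∑ x : ZMod p, ZMod.stdAddChar (x ^ 2) =
      gaussSum ((quadraticChar (ZMod p)).ringHomComp (Int.castRingHom ℂ)) ZMod.stdAddChar := by
    refine Eq.trans ?_ (add_zero _)
    rw [gaussSum, ← Finset.sum_fiberwise_of_maps_to (s := Finset.univ) (t := Finset.univ)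
        (g := fun x : ZMod p ↦ x ^ 2) (by simp)]
    refine Eq.trans ?_ (congrArg _ h0)
    rw [← Finset.sum_add_distrib]
    refine Finset.sum_congr rfl fun b _ ↦ ?_
    have hc := quadraticChar_card_sqrts hp2 b
    rw [Finset.sum_congr rfl (g := fun _ ↦ ZMod.stdAddChar b) (by
      intro x hx; rw [(Finset.mem_filter.1 hx).2]), Finset.sum_const, nsmul_eq_mul]
    have : (Finset.filter (fun x : ZMod p ↦ x ^ 2 = b) Finset.univ) =
        {x : ZMod p | x ^ 2 = b}.toFinset := by ext; simp
    rw [this]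
    have hc' := congrArg (Int.cast : ℤ → ℂ) hc
    push_cast at hc'
    rw [hc']
    simp
    ring
  rw [← h1]
  obtain ⟨q, rfl⟩ : ∃ q, p = q + 1 := ⟨p - 1, by omega⟩
  change ∑ x : Fin (q + 1), ZMod.stdAddChar (N := q + 1) ((x : ZMod (q + 1)) ^ 2) = _
  refine Finset.sum_congr rfl fun a _ ↦ ?_
  have : ((a : ZMod (q + 1)) ^ 2) = (((a : ℕ) ^ 2 : ℤ) : ZMod (q + 1)) := by
    have := ZMod.natCast_zmod_val (n := q + 1) a
    push_cast
    congr 1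
    exact this.symm
  rw [this, ZMod.stdAddChar_coe]
  congr 1
  push_cast
  ring

end GaussSign

section QuadraticCharacter

open Complex

/-- The Legendre symbol modulo `p` as a complex Dirichlet character. -/
noncomputable abbrev legendreChar (p : ℕ) [Fact p.Prime] : DirichletCharacter ℂ p :=
  (quadraticChar (ZMod p)).ringHomComp (Int.castRingHom ℂ)

variable (p : ℕ) [Fact p.Prime]

lemma legendreChar_ne_one (hp : p ≠ 2) : legendreChar p ≠ 1 := by
  refine (MulChar.ringHomComp_ne_one_iff (RingHom.injective_int _)).2 (quadraticChar_ne_one ?_)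
  rwa [ZMod.ringChar_zmod_n]

lemma isPrimitive_legendreChar (hp : p ≠ 2) : (legendreChar p).IsPrimitive := by
  rw [DirichletCharacter.isPrimitive_def]
  refine ((Nat.dvd_prime Fact.out).1 (DirichletCharacter.conductor_dvd_level _)).resolve_left ?_
  exact fun h ↦ legendreChar_ne_one p hp
    ((DirichletCharacter.eq_one_iff_conductor_eq_one).2 h)

lemma legendreChar_inv : (legendreChar p)⁻¹ = legendreChar p :=
  ((quadraticChar_isQuadratic (ZMod p)).comp _).inv

lemma legendreChar_neg (hp : p % 4 = 3) (a : ZMod p) : legendreChar p (-a) = -legendreChar p a := by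
  have h : quadraticChar (ZMod p) (-1) = -1 := by
    rw [quadraticChar_neg_one (by rw [ZMod.ringChar_zmod_n]; omega), ZMod.card,
      ZMod.χ₄_nat_three_mod_four hp]
  rw [← neg_one_mul a, map_mul, MulChar.ringHomComp_apply, h]
  simp

lemma LFunction_legendreChar_zero (hp : p % 4 = 3) :
    DirichletCharacter.LFunction (legendreChar p) 0 =
      (√p / Real.pi : ℝ) * DirichletCharacter.LFunction (legendreChar p) 1 := by
  have hp2 : p ≠ 2 := by omega
  have hpi : (Real.pi : ℂ) ≠ 0 := ofReal_ne_zero.2 Real.pi_ne_zero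
  have key : ZMod.dft (legendreChar p) = fun k ↦ -(I * (√p : ℝ)) * legendreChar p k := by
    ext k
    rw [(isPrimitive_legendreChar p hp2).fourierTransform_eq_inv_mul_gaussSum, legendreChar_inv,
      legendreChar_neg p hp, gaussSum_quadraticChar_eq p hp]
    ring
  have key' : ZMod.dft (fun x ↦ legendreChar p (-x)) =
      fun k ↦ (I * (√p : ℝ)) * legendreChar p k := by
    rw [ZMod.dft_comp_neg, key]
    ext k
    simp only [legendreChar_neg p hp]
    ring
  have hmul (c : ℂ) : ZMod.LFunction (fun k ↦ c * legendreChar p k) 1 =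
      c * ZMod.LFunction (legendreChar p) 1 := by
    simp only [ZMod.LFunction, Finset.mul_sum]
    exact Finset.sum_congr rfl fun _ _ ↦ by ring
  have := ZMod.LFunction_one_sub (legendreChar p) (s := 1)
    (fun n h ↦ by
      have := congrArg re h
      simp at this
      linarith [Nat.cast_nonneg (α := ℝ) n]) (.inl (by simp))
  rw [key, key', hmul, hmul, sub_self, cpow_zero, Gamma_one, mul_one, cpow_neg_one,
    show Real.pi * I * 1 / 2 = Real.pi / 2 * I by ring,
    show -Real.pi * I * 1 / 2 = -(Real.pi / 2 * I) by ring, one_mul,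
    exp_neg, exp_pi_div_two_mul_I, inv_I] at this
  rw [DirichletCharacter.LFunction, DirichletCharacter.LFunction, this]
  push_cast
  field_simp
  linear_combination (-(2 * (√p : ℝ)) * ZMod.LFunction (legendreChar p) 1 : ℂ) * I_sq

end QuadraticCharacter

section ResidueComparison

open Complex Filter Topology NumberField

lemma LFunction_one_eq_dedekindZeta_residue {K : Type*} [Field K] [NumberField K] {N : ℕ} [NeZero N]
    {χ : DirichletCharacter ℂ N} (hχ : χ ≠ 1)
    (h : ∀ n ≠ 0, (Nat.card {I : Ideal (𝓞 K) // Ideal.absNorm I = n} : ℂ) = χ.zetaMul n) :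
    DirichletCharacter.LFunction χ 1 = dedekindZeta_residue K := by
  have hfac {s : ℂ} (hs : 1 < s.re) :
      dedekindZeta K s = riemannZeta s * DirichletCharacter.LFunction χ s := by
    have hs' : LSeriesSummable (toArithmeticFunction (χ ·)) s := by
      refine (LSeriesSummable_congr _ fun {n} hn ↦ ?_).1
        (DirichletCharacter.LSeriesSummable_of_one_lt_re χ hs)
      simp [toArithmeticFunction, hn]
    have hz : LSeriesSummable ((ArithmeticFunction.zeta : ArithmeticFunction ℂ) ·) s :=
      (LSeriesSummable_congr _ fun {n} hn ↦ by simp [hn]).1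
        (ArithmeticFunction.LSeriesSummable_zeta_iff.2 hs)
    rw [dedekindZeta, LSeries_congr (fun {n} hn ↦ h n hn), DirichletCharacter.zetaMul,
      ArithmeticFunction.LSeries_mul' hz hs', DirichletCharacter.LFunction_eq_LSeries χ hs,
      ← ArithmeticFunction.LSeries_zeta_eq_riemannZeta hs]
    congr 1
    exact LSeries_congr (fun {n} hn ↦ by simp [toArithmeticFunction, hn]) s
  have hcast : Tendsto (fun s : ℝ ↦ (s : ℂ)) (𝓝[>] 1) (𝓝[≠] 1) := by
    refine tendsto_nhdsWithin_iff.2 ⟨?_, ?_⟩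
    · simpa using (continuous_ofReal.tendsto 1).mono_left nhdsWithin_le_nhds
    · filter_upwards [self_mem_nhdsWithin] with s hs h1
      exact (Set.mem_Ioi.1 hs).ne' (ofReal_eq_one.1 h1)
  have h1 := (riemannZeta_residue_one.comp hcast).mul
    (((DirichletCharacter.differentiable_LFunction hχ).continuous.tendsto 1).comp
      (hcast.mono_right nhdsWithin_le_nhds))
  have h2 := tendsto_sub_one_mul_dedekindZeta_nhdsGT K
  rw [one_mul] at h1
  refine tendsto_nhds_unique (h1.congr' ?_) h2
  filter_upwards [self_mem_nhdsWithin] with s hs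
  simp only [Function.comp_apply]
  rw [hfac (by simpa using hs), mul_assoc]

end ResidueComparison

section ImaginaryQuadratic

open NumberField

lemma exists_rat_add_rat_mul {p : ℕ} {K : Type*} [Field K] [NumberField K] {α : K}
    (hα : α ^ 2 = -(p : K)) (hgen : Algebra.adjoin ℚ ({α} : Set K) = ⊤) (x : K) :
    ∃ r s : ℚ, x = r + s * α := by
  have hx : x ∈ Algebra.adjoin ℚ ({α} : Set K) := hgen ▸ Algebra.mem_top
  induction hx using Algebra.adjoin_induction with
  | mem x hx => exact ⟨0, 1, by simpa using hx⟩
  | algebraMap r => exact ⟨r, 0, by simp⟩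
  | add x y _ _ hx hy =>
    obtain ⟨r, s, rfl⟩ := hx
    obtain ⟨r', s', rfl⟩ := hy
    exact ⟨r + r', s + s', by push_cast; ring⟩
  | mul x y _ _ hx hy =>
    obtain ⟨r, s, rfl⟩ := hx
    obtain ⟨r', s', rfl⟩ := hy
    refine ⟨r * r' - p * (s * s'), r * s' + s * r', ?_⟩
    push_cast
    linear_combination (s * s' : K) * hα

lemma re_eq_zero_and_im_sq_of_sq_eq_neg {p : ℕ} (hp : 0 < p) {z : ℂ} (hz : z ^ 2 = -(p : ℂ)) :
    z.re = 0 ∧ z.im ^ 2 = p := by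
  have h1 := congrArg Complex.re hz
  have h2 := congrArg Complex.im hz
  simp only [pow_two, Complex.mul_re, Complex.mul_im, Complex.neg_re, Complex.neg_im,
    Complex.natCast_re, Complex.natCast_im] at h1 h2
  have hp' : (0 : ℝ) < p := Nat.cast_pos.2 hp
  have h3 : z.re * z.im = 0 := by linarith
  rcases mul_eq_zero.1 h3 with h | h
  · exact ⟨h, by rw [h] at h1; linarith⟩
  · rw [h] at h1
    nlinarith [mul_self_nonneg z.re]

lemma exists_int_of_isIntegral_complex {r : ℚ} (h : IsIntegral ℤ (r : ℂ)) : ∃ m : ℤ, (m : ℚ) = r := by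
  have : IsIntegral ℤ (algebraMap ℚ ℂ r) := by simpa using h
  rw [isIntegral_algebraMap_iff (algebraMap ℚ ℂ).injective] at this
  exact IsIntegrallyClosed.isIntegral_iff.1 this

lemma exists_int_div_two_of_isIntegral {p : ℕ} [Fact p.Prime] {K : Type*} [Field K] [NumberField K]
    {α : K} (hp4 : p % 4 = 3) (hα : α ^ 2 = -(p : K)) {r s : ℚ} (h : IsIntegral ℤ (r + s * α)) :
    ∃ m n : ℤ, (m : ℚ) = 2 * r ∧ (n : ℚ) = 2 * s ∧ (2 : ℤ) ∣ m - n := by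
  have hp0 : 0 < p := NeZero.pos p
  obtain ⟨φ⟩ : Nonempty (K →+* ℂ) := inferInstance
  obtain ⟨hre, him⟩ := re_eq_zero_and_im_sq_of_sq_eq_neg hp0 (z := φ α) (by
    rw [← map_pow, hα]; simp)
  have hφ : IsIntegral ℤ (r + s * φ α : ℂ) := by
    simpa using h.map φ.toIntAlgHom
  have hφ' : IsIntegral ℤ (r - s * φ α : ℂ) := by
    have := hφ.map (starRingEnd ℂ).toIntAlgHom
    have e : (starRingEnd ℂ) (φ α) = - φ α := by
      apply Complex.ext <;> simp [hre]
    simpa [e, sub_eq_add_neg] using this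
  obtain ⟨m, hm⟩ := exists_int_of_isIntegral_complex (r := 2 * r) (by
    have e : ((2 * r : ℚ) : ℂ) = (r + s * φ α) + (r - s * φ α) := by
      push_cast
      ring
    rw [e]
    exact hφ.add hφ')
  have hsq : φ α ^ 2 = -(p : ℂ) := by rw [← map_pow, hα]; simp
  obtain ⟨k, hk⟩ := exists_int_of_isIntegral_complex (r := r ^ 2 + p * s ^ 2) (by
    have e : ((r ^ 2 + p * s ^ 2 : ℚ) : ℂ) = (r + s * φ α) * (r - s * φ α) := by
      push_cast
      linear_combination (s ^ 2 : ℂ) * hsq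
    rw [e]
    exact hφ.mul hφ')
  obtain ⟨t, ht⟩ : ∃ t : ℤ, (t : ℚ) = p * (2 * s) := by
    refine IsIntegrallyClosed.isIntegral_iff.1 (.of_pow two_pos ?_)
    have : (p * (2 * s)) ^ 2 = algebraMap ℤ ℚ (p * (4 * k - m ^ 2)) := by
      simp only [algebraMap_int_eq, eq_intCast]
      push_cast
      rw [hm, hk]
      ring
    rw [this]
    exact isIntegral_algebraMap
  have ht2 : t ^ 2 = p * (4 * k - m ^ 2) := by
    have : (t ^ 2 : ℚ) = p * (4 * k - m ^ 2) := by
      rw [hm, hk, ht]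
      ring
    exact_mod_cast this
  have hpt : (p : ℤ) ∣ t :=
    (Nat.prime_iff_prime_int.1 Fact.out).dvd_of_dvd_pow (Dvd.intro _ ht2.symm)
  obtain ⟨n, rfl⟩ := hpt
  have hn : (n : ℚ) = 2 * s := by
    have : (p : ℚ) ≠ 0 := by positivity
    push_cast at ht
    exact mul_left_cancel₀ this ht
  refine ⟨m, n, hm, hn, ?_⟩
  have h4 : m ^ 2 + p * n ^ 2 = 4 * k := by
    have : (m ^ 2 + p * n ^ 2 : ℚ) = 4 * k := by
      rw [hm, hk, hn]
      ring
    exact_mod_cast this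
  obtain ⟨q, hq⟩ : ∃ q : ℕ, p = 4 * q + 3 := ⟨p / 4, by omega⟩
  rw [hq] at h4
  have h5 : Even ((m - n) ^ 2) := by
    refine ⟨2 * k - 2 * q * n ^ 2 - n ^ 2 - m * n, ?_⟩
    push_cast at h4
    linear_combination h4
  exact even_iff_two_dvd.1 ((Int.even_pow' two_ne_zero).1 h5)

/-- The ring of integers of `ℚ(√-p)`, `p ≡ 3 (mod 4)`, is generated over `ℤ` by `(1 + √-p) / 2`. -/
lemma exists_integral_generator {p : ℕ} [Fact p.Prime] {K : Type*} [Field K] [NumberField K]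
    {α : K} (hp4 : p % 4 = 3) (hα : α ^ 2 = -(p : K))
    (hgen : Algebra.adjoin ℚ ({α} : Set K) = ⊤) :
    ∃ θ : 𝓞 K, θ ^ 2 = θ - ((p + 1) / 4 : ℕ) ∧ ∀ x : 𝓞 K, ∃ a b : ℤ, x = a + b * θ := by
  obtain ⟨c, hc⟩ : ∃ c : ℕ, p + 1 = 4 * c := ⟨(p + 1) / 4, by omega⟩
  have hc' : (p : K) + 1 = 4 * c := by exact_mod_cast hc
  have hquad : ((1 + α) / 2) ^ 2 = (1 + α) / 2 - c := by
    field_simp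
    linear_combination hα - hc'
  have hint : IsIntegral ℤ ((1 + α) / 2) := by
    refine ⟨.X ^ 2 - .X + .C (c : ℤ), by monicity!, ?_⟩
    simp only [algebraMap_int_eq, Polynomial.eval₂_add, Polynomial.eval₂_sub, Polynomial.eval₂_pow,
      Polynomial.eval₂_X, Polynomial.eval₂_C, hquad]
    simp
  obtain ⟨θ, hθ⟩ : ∃ θ : 𝓞 K, algebraMap (𝓞 K) K θ = (1 + α) / 2 :=
    ⟨⟨_, hint⟩, rfl⟩
  refine ⟨θ, ?_, fun x ↦ ?_⟩
  · rw [hc, Nat.mul_div_cancel_left _ four_pos]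
    apply RingOfIntegers.ext
    change algebraMap (𝓞 K) K (θ ^ 2) = algebraMap (𝓞 K) K (θ - c)
    rw [map_pow, map_sub, map_natCast, hθ, hquad]
  · obtain ⟨r, s, hx⟩ := exists_rat_add_rat_mul hα hgen x
    obtain ⟨m, n, hm, hn, k, hk⟩ := exists_int_div_two_of_isIntegral hp4 hα
      (by
        rw [← hx]
        exact RingOfIntegers.isIntegral_coe x)
    refine ⟨k, n, ?_⟩
    apply RingOfIntegers.ext
    rw [hx]
    have hm' : (m : K) = 2 * r := by exact_mod_cast congrArg (Rat.cast : ℚ → K) hm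
    have hn' : (n : K) = 2 * s := by exact_mod_cast congrArg (Rat.cast : ℚ → K) hn
    have hk' : (m : K) - n = 2 * k := by exact_mod_cast congrArg (Int.cast : ℤ → K) hk
    simp only [map_add, map_mul, map_intCast, hθ]
    linear_combination (-1 / 2) * hm' - (α / 2) * hn' + 1 / 2 * hk'

variable {p : ℕ} {K : Type*} [Field K] {θ : 𝓞 K}

lemma re_and_im_sq_of_integral_generator (hp4 : p % 4 = 3)
    (hθ : θ ^ 2 = θ - ((p + 1) / 4 : ℕ)) (φ : 𝓞 K →+* ℂ) :
    (φ θ).re = 1 / 2 ∧ (φ θ).im ^ 2 = p / 4 := by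
  obtain ⟨c, hc⟩ : ∃ c : ℕ, p + 1 = 4 * c := ⟨(p + 1) / 4, by omega⟩
  rw [hc, Nat.mul_div_cancel_left _ four_pos] at hθ
  have h1 : (φ θ) ^ 2 = φ θ - c := by rw [← map_pow, hθ]; simp
  have hc' : (p : ℂ) + 1 = 4 * c := by exact_mod_cast hc
  obtain ⟨hre, him⟩ := re_eq_zero_and_im_sq_of_sq_eq_neg (by omega : 0 < p) (z := 2 * φ θ - 1) (by
    linear_combination 4 * h1 + hc')
  simp at hre him
  constructor <;> linarith

variable [NumberField K]

lemma int_eq_zero_of_add_mul_eq_zero (hp4 : p % 4 = 3) (hθ : θ ^ 2 = θ - ((p + 1) / 4 : ℕ))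
    {a b : ℤ} (h : (a + b * θ : 𝓞 K) = 0) : a = 0 ∧ b = 0 := by
  obtain ⟨ψ⟩ : Nonempty (K →+* ℂ) := inferInstance
  let φ := ψ.comp (algebraMap (𝓞 K) K)
  obtain ⟨hre, him⟩ := re_and_im_sq_of_integral_generator hp4 hθ φ
  have h1 := congrArg φ h
  have hp : (0 : ℝ) < p := Nat.cast_pos.2 (by omega)
  have him0 : (φ θ).im ≠ 0 := fun h ↦ by rw [h] at him; linarith
  have h2 := congrArg Complex.im h1
  have hb : b = 0 := by simpa [him0] using h2
  subst hb
  exact ⟨by simpa using h, rfl⟩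

/-- The integral basis `1, θ`. -/
noncomputable def quadraticIntegralBasis (hp4 : p % 4 = 3) (hθ : θ ^ 2 = θ - ((p + 1) / 4 : ℕ))
    (hspan : ∀ x : 𝓞 K, ∃ a b : ℤ, x = a + b * θ) : Module.Basis (Fin 2) ℤ (𝓞 K) :=
  .mk (v := ![1, θ])
    (LinearIndependent.pair_iff.2 fun a b h ↦ int_eq_zero_of_add_mul_eq_zero hp4 hθ (by
      simpa using h))
    (fun x _ ↦ by
      obtain ⟨a, b, rfl⟩ := hspan x
      rw [Matrix.range_cons, Matrix.range_cons, Matrix.range_empty, Set.union_empty,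
        Set.singleton_union, Submodule.mem_span_pair]
      exact ⟨a, b, by simp⟩)

lemma finrank_eq_two (hp4 : p % 4 = 3) (hθ : θ ^ 2 = θ - ((p + 1) / 4 : ℕ))
    (hspan : ∀ x : 𝓞 K, ∃ a b : ℤ, x = a + b * θ) : Module.finrank ℚ K = 2 := by
  rw [← RingOfIntegers.rank, Module.finrank_eq_card_basis (quadraticIntegralBasis hp4 hθ hspan),
    Fintype.card_fin]

lemma discr_eq_neg (hp4 : p % 4 = 3) (hθ : θ ^ 2 = θ - ((p + 1) / 4 : ℕ))
    (hspan : ∀ x : 𝓞 K, ∃ a b : ℤ, x = a + b * θ) : discr K = -p := by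
  set b := quadraticIntegralBasis hp4 hθ hspan with hb
  have hb0 : b 0 = 1 := by simp [hb, quadraticIntegralBasis]
  have hb1 : b 1 = θ := by simp [hb, quadraticIntegralBasis]
  have hr0 : b.repr 1 = Finsupp.single 0 1 := by rw [← hb0, b.repr_self]
  have hr1 : b.repr θ = Finsupp.single 1 1 := by rw [← hb1, b.repr_self]
  set c := (p + 1) / 4 with hc
  have hpc : (p : ℤ) = 4 * c - 1 := by omega
  have hc1 : (c : 𝓞 K) = (c : ℤ) • (1 : 𝓞 K) := by simp
  have t1 : Algebra.trace ℤ (𝓞 K) 1 = 2 := by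
    rw [Algebra.trace_eq_matrix_trace b, Matrix.trace_fin_two]
    simp
  have tθ : Algebra.trace ℤ (𝓞 K) θ = 1 := by
    rw [Algebra.trace_eq_matrix_trace b, Matrix.trace_fin_two, Algebra.leftMulMatrix_eq_repr_mul,
      Algebra.leftMulMatrix_eq_repr_mul, hb0, hb1, mul_one, ← pow_two, hθ, map_sub, hc1, map_smul,
      hr0, hr1]
    simp
  have tθ2 : Algebra.trace ℤ (𝓞 K) (θ * θ) = 1 - 2 * c := by
    rw [← pow_two, hθ, map_sub, tθ, hc1, map_smul, t1, smul_eq_mul, mul_comm]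
  rw [← discr_eq_discr K b, Algebra.discr_def, Matrix.det_fin_two]
  simp only [Algebra.traceMatrix_apply, Algebra.traceForm_apply, hb0, hb1, mul_one, one_mul, t1,
    tθ, tθ2, hpc]
  ring

lemma nrRealPlaces_eq_zero (hp4 : p % 4 = 3) (hθ : θ ^ 2 = θ - ((p + 1) / 4 : ℕ)) :
    InfinitePlace.nrRealPlaces K = 0 := by
  rw [nrRealPlaces_eq_zero_iff]
  refine ⟨fun w ↦ ?_⟩
  rw [← InfinitePlace.not_isReal_iff_isComplex, InfinitePlace.isReal_iff]
  intro h
  obtain ⟨hre, him⟩ := re_and_im_sq_of_integral_generator hp4 hθ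
    (w.embedding.comp (algebraMap (𝓞 K) K))
  have h1 := congrArg Complex.im (RingHom.congr_fun h (θ : K))
  have hp : (0 : ℝ) < p := Nat.cast_pos.2 (by omega)
  simp only [ComplexEmbedding.conjugate_coe_eq, Complex.conj_im] at h1
  simp only [RingHom.comp_apply] at him
  have : (w.embedding (θ : K)).im = 0 := by linarith
  rw [this] at him
  linarith

lemma nrComplexPlaces_eq_one (hp4 : p % 4 = 3) (hθ : θ ^ 2 = θ - ((p + 1) / 4 : ℕ))
    (hspan : ∀ x : 𝓞 K, ∃ a b : ℤ, x = a + b * θ) : InfinitePlace.nrComplexPlaces K = 1 := by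
  have := InfinitePlace.card_add_two_mul_card_eq_rank K
  rw [nrRealPlaces_eq_zero hp4 hθ, finrank_eq_two hp4 hθ hspan] at this
  omega

lemma regulator_eq_one (hp4 : p % 4 = 3) (hθ : θ ^ 2 = θ - ((p + 1) / 4 : ℕ))
    (hspan : ∀ x : 𝓞 K, ∃ a b : ℤ, x = a + b * θ) : Units.regulator K = 1 := by
  classical
  have hcard : Fintype.card (InfinitePlace K) = 1 := by
    rw [InfinitePlace.card_eq_nrRealPlaces_add_nrComplexPlaces, nrRealPlaces_eq_zero hp4 hθ,
      nrComplexPlaces_eq_one hp4 hθ hspan]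
  have : IsEmpty {w : InfinitePlace K // w ≠ Units.dirichletUnitTheorem.w₀} :=
    ⟨fun w ↦ w.2 (Fintype.card_le_one_iff.1 hcard.le _ _)⟩
  rw [Units.regulator_eq_det', Matrix.det_isEmpty, abs_one]

lemma torsionOrder_eq_two (hp4 : p % 4 = 3) (hp : 3 < p) (hθ : θ ^ 2 = θ - ((p + 1) / 4 : ℕ))
    (hspan : ∀ x : 𝓞 K, ∃ a b : ℤ, x = a + b * θ) : Units.torsionOrder K = 2 := by
  have key (u : Units.torsion K) : (u : (𝓞 K)ˣ) = 1 ∨ (u : (𝓞 K)ˣ) = -1 := by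
    obtain ⟨w⟩ : Nonempty (InfinitePlace K) := inferInstance
    have hu := (Units.mem_torsion K).1 u.2 w
    obtain ⟨a, b, hab⟩ := hspan ((u : (𝓞 K)ˣ) : 𝓞 K)
    obtain ⟨hre, him⟩ := re_and_im_sq_of_integral_generator hp4 hθ
      (w.embedding.comp (algebraMap (𝓞 K) K))
    simp only [RingHom.comp_apply] at hre him
    have h1 : Complex.normSq (w.embedding ((u : (𝓞 K)ˣ) : 𝓞 K)) = 1 := by
      rw [Complex.normSq_eq_norm_sq, InfinitePlace.norm_embedding_eq, hu, one_pow]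
    rw [hab, Complex.normSq_apply] at h1
    simp only [map_add, map_mul, map_intCast, Complex.add_re, Complex.intCast_re, Complex.mul_re,
      hre, Complex.intCast_im, zero_mul, sub_zero, Complex.add_im, Complex.mul_im,
      zero_add, add_zero] at h1
    have h2 : (2 * a + b) ^ 2 + p * b ^ 2 = 4 := by
      have : ((2 * a + b) ^ 2 + p * b ^ 2 : ℝ) = 4 := by
        linear_combination 4 * h1 - 4 * (b : ℝ) ^ 2 * him
      exact_mod_cast this
    have hb : b = 0 := by
      by_contra hb
      have hb1 : 1 ≤ b ^ 2 := Int.add_one_le_iff.2 (sq_pos_of_ne_zero hb)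
      have hp7 : (7 : ℤ) ≤ p := by omega
      nlinarith [sq_nonneg (2 * a + b)]
    subst hb
    have ha : a ^ 2 = 1 := by linarith
    rcases eq_or_eq_neg_of_sq_eq_sq a 1 (by rw [ha, one_pow]) with rfl | rfl
    · left; ext; simp [hab]
    · right; ext; simp [hab]
  refine le_antisymm ?_ (Nat.le_of_dvd (Units.torsionOrder_pos K)
    (even_iff_two_dvd.1 (Units.even_torsionOrder K)))
  have hsub : (Units.torsion K : Set (𝓞 K)ˣ) ⊆ {1, -1} := fun u hu ↦ key ⟨u, hu⟩
  calc Units.torsionOrder K = (Units.torsion K : Set (𝓞 K)ˣ).ncard := rfl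
    _ ≤ ({1, -1} : Set (𝓞 K)ˣ).ncard := Set.ncard_le_ncard hsub
    _ ≤ 2 := (Set.ncard_insert_le _ _).trans (by simp)

lemma dedekindZeta_residue_eq (hp4 : p % 4 = 3) (hp : 3 < p)
    (hθ : θ ^ 2 = θ - ((p + 1) / 4 : ℕ)) (hspan : ∀ x : 𝓞 K, ∃ a b : ℤ, x = a + b * θ) :
    dedekindZeta_residue K = Real.pi * classNumber K / √p := by
  rw [dedekindZeta_residue_def, nrRealPlaces_eq_zero hp4 hθ, nrComplexPlaces_eq_one hp4 hθ hspan,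
    regulator_eq_one hp4 hθ hspan, torsionOrder_eq_two hp4 hp hθ hspan, discr_eq_neg hp4 hθ hspan]
  have : (0 : ℝ) < √p := Real.sqrt_pos.2 (Nat.cast_pos.2 (by omega))
  simp
  field_simp

end ImaginaryQuadratic

section IdealCount

open Ideal

variable {R : Type*} [CommRing R]

lemma eq_top_of_natCast_mem_of_coprime {I : Ideal R} {m n : ℕ} (hmn : m.Coprime n)
    (hm : (m : R) ∈ I) (hn : (n : R) ∈ I) : I = ⊤ := by
  obtain ⟨a, b, hab⟩ := Nat.isCoprime_iff_coprime.2 hmn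
  rw [eq_top_iff_one]
  have : (1 : R) = a * m + b * n := by exact_mod_cast congrArg (Int.cast : ℤ → R) hab.symm
  rw [this]
  exact I.add_mem (I.mul_mem_left _ hm) (I.mul_mem_left _ hn)

variable [IsDedekindDomain R]

lemma le_of_pow_mul_pow_eq {P Q : Ideal R} [hP : P.IsMaximal] [hQ : Q.IsMaximal] (hPQ : P ≠ Q)
    (hP0 : P ≠ ⊥) {i j i' j' : ℕ} (h : P ^ i * Q ^ j = P ^ i' * Q ^ j') : i' ≤ i := by
  by_contra! hi
  obtain ⟨d, rfl⟩ := Nat.exists_eq_add_of_lt hi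
  rw [add_assoc, pow_add, mul_assoc] at h
  have h1 := mul_left_cancel₀ (pow_ne_zero i hP0) h
  have h2 : Q ^ j ≤ P := by
    rw [h1, pow_succ, mul_assoc]
    exact mul_le_right.trans mul_le_left
  exact hPQ (hQ.eq_of_le hP.ne_top (hP.isPrime.le_of_pow_le h2)).symm

variable [Module.Free ℤ R]

lemma eq_of_le_of_absNorm_eq {I J : Ideal R} (h : I ≤ J) (hIJ : absNorm I = absNorm J)
    (hJ : absNorm J ≠ 0) : I = J := by
  obtain ⟨L, rfl⟩ := dvd_iff_le.2 h
  rw [map_mul, Nat.mul_eq_left hJ, absNorm_eq_one_iff] at hIJ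
  rw [hIJ, mul_top]

lemma mul_sup_span_absNorm_eq {I J : Ideal R} (h : (absNorm I).Coprime (absNorm J)) :
    I * J ⊔ span {(absNorm I : R)} = I := by
  refine le_antisymm (sup_le mul_le_left (span_singleton_absNorm_le I)) ?_
  have htop : J ⊔ span {(absNorm I : R)} = ⊤ :=
    eq_top_of_natCast_mem_of_coprime h (mem_sup_right (mem_span_singleton_self _))
      (mem_sup_left (absNorm_mem J))
  calc I = I * (J ⊔ span {(absNorm I : R)}) := by rw [htop, mul_top]
    _ = I * J ⊔ I * span {(absNorm I : R)} := Ideal.mul_sup _ _ _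
    _ ≤ I * J ⊔ span {(absNorm I : R)} := sup_le_sup_left mul_le_right _

lemma sup_span_mul_sup_span_eq {I : Ideal R} {m n : ℕ} (hmn : m.Coprime n)
    (hI : absNorm I = m * n) : (I ⊔ span {(m : R)}) * (I ⊔ span {(n : R)}) = I := by
  refine le_antisymm ?_ ?_
  · rw [Ideal.sup_mul, Ideal.mul_sup, Ideal.mul_sup, span_singleton_mul_span_singleton, ← Nat.cast_mul, ← hI]
    exact sup_le (sup_le mul_le_left mul_le_left)
      (sup_le mul_le_right (span_singleton_absNorm_le I))
  · rw [mul_eq_inf_of_coprime]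
    · exact le_inf le_sup_left le_sup_left
    · exact eq_top_of_natCast_mem_of_coprime hmn
        (mem_sup_left (mem_sup_right (mem_span_singleton_self _)))
        (mem_sup_right (mem_sup_right (mem_span_singleton_self _)))

lemma absNorm_sup_span_eq [Module.Finite ℤ R] {I : Ideal R} {m n : ℕ} (hm : m ≠ 0) (hn : n ≠ 0)
    (hmn : m.Coprime n) (hI : absNorm I = m * n) :
    absNorm (I ⊔ span {(m : R)}) = m ∧ absNorm (I ⊔ span {(n : R)}) = n := by
  have hdvd {a b : ℕ} (hab : a.Coprime b) (hI : absNorm I = a * b) :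
      absNorm (I ⊔ span {(a : R)}) ∣ a := by
    have h1 : absNorm (I ⊔ span {(a : R)}) ∣ a ^ Module.finrank ℤ R := by
      rw [← absNorm_span_natCast]
      exact absNorm_dvd_absNorm_of_le le_sup_right
    have h2 : absNorm (I ⊔ span {(a : R)}) ∣ a * b := by
      rw [← hI]
      exact absNorm_dvd_absNorm_of_le le_sup_left
    exact (Nat.Coprime.coprime_dvd_left h1 (hab.pow_left _)).dvd_of_dvd_mul_right h2
  have h1 := hdvd hmn hI
  have h2 := hdvd hmn.symm (hI.trans (mul_comm _ _))
  have h3 := congrArg absNorm (sup_span_mul_sup_span_eq hmn hI)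
  rw [map_mul, hI] at h3
  exact ⟨(Nat.le_of_dvd (Nat.pos_of_ne_zero hm) h1).antisymm <| by
      by_contra! h
      exact (Nat.mul_lt_mul_of_lt_of_le h (Nat.le_of_dvd (Nat.pos_of_ne_zero hn) h2)
        (Nat.pos_of_ne_zero hn)).ne h3,
    (Nat.le_of_dvd (Nat.pos_of_ne_zero hn) h2).antisymm <| by
      by_contra! h
      exact (Nat.mul_lt_mul_of_le_of_lt (Nat.le_of_dvd (Nat.pos_of_ne_zero hm) h1) h
        (Nat.pos_of_ne_zero hm)).ne h3⟩

variable (R) in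
/-- The number of ideals of a given nonzero norm. -/
noncomputable def idealCount : ArithmeticFunction ℂ where
  toFun n := if n = 0 then 0 else Nat.card {I : Ideal R // absNorm I = n}
  map_zero' := if_pos rfl

lemma idealCount_apply {n : ℕ} (hn : n ≠ 0) :
    idealCount R n = Nat.card {I : Ideal R // absNorm I = n} := if_neg hn

lemma isMultiplicative_idealCount [Module.Finite ℤ R] : (idealCount R).IsMultiplicative := by
  rw [ArithmeticFunction.IsMultiplicative.iff_ne_zero]
  refine ⟨?_, fun {m n} hm hn hmn ↦ ?_⟩
  · simp [idealCount_apply one_ne_zero, absNorm_eq_one_iff]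
  · rw [idealCount_apply hm, idealCount_apply hn, idealCount_apply (mul_ne_zero hm hn),
      ← Nat.cast_mul, ← Nat.card_prod]
    refine congrArg Nat.cast (Nat.card_congr ⟨
      fun I ↦ (⟨_, (absNorm_sup_span_eq hm hn hmn I.2).1⟩, ⟨_, (absNorm_sup_span_eq hm hn hmn I.2).2⟩),
      fun I ↦ ⟨I.1.1 * I.2.1, by rw [map_mul, I.1.2, I.2.2]⟩,
      fun I ↦ Subtype.ext (sup_span_mul_sup_span_eq hmn I.2), ?_⟩)
    rintro ⟨⟨I, rfl⟩, ⟨J, rfl⟩⟩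
    ext1 <;> apply Subtype.ext
    · exact mul_sup_span_absNorm_eq hmn
    · change I * J ⊔ _ = J
      rw [mul_comm]
      exact mul_sup_span_absNorm_eq hmn.symm

/-- If every maximal ideal containing `q` is one of `P`, `Q`, then every ideal whose norm is a power
of `q` is a product of powers of `P` and `Q`. -/
lemma exists_eq_pow_mul_pow {P Q : Ideal R} [hP : P.IsMaximal] [hQ : Q.IsMaximal] {q : ℕ}
    (hq : q.Prime) (hPQ : P * Q ≤ span {(q : R)}) {I : Ideal R} {k : ℕ} (hI : absNorm I = q ^ k) :
    ∃ i j, I = P ^ i * Q ^ j := by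
  induction k using Nat.strong_induction_on generalizing I with
  | _ k ih =>
    by_cases htop : I = ⊤
    · exact ⟨0, 0, by simpa using htop⟩
    obtain ⟨M, hM, hIM⟩ := exists_le_maximal I htop
    have hqM : (q : R) ∈ M := by
      refine hM.isPrime.mem_of_pow_mem k (hIM ?_)
      rw [← Nat.cast_pow, ← hI]
      exact absNorm_mem I
    have hM1 : absNorm M ≠ 1 := absNorm_eq_one_iff.not.2 hM.ne_top
    obtain ⟨J, rfl⟩ := dvd_iff_le.2 hIM
    rw [map_mul] at hI
    obtain ⟨l, hl, hJ⟩ := (Nat.dvd_prime_pow hq).1 (Dvd.intro_left _ hI)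
    have hlk : l < k := by
      refine hl.lt_of_ne fun h ↦ hM1 ?_
      rw [hJ, h] at hI
      exact (Nat.mul_eq_right (pow_pos hq.pos k).ne').1 hI
    obtain ⟨i, j, hij⟩ := ih l hlk hJ
    rcases hM.isPrime.mul_le.1 (hPQ.trans ((span_singleton_le_iff_mem _).2 hqM)) with h | h
    · refine ⟨i + 1, j, ?_⟩
      rw [← hP.eq_of_le hM.ne_top h, hij]
      ring
    · refine ⟨i, j + 1, ?_⟩
      rw [← hQ.eq_of_le hM.ne_top h, hij]
      ring

lemma card_absNorm_eq_of_inert {P : Ideal R} [P.IsMaximal] {q : ℕ} (hq : q.Prime)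
    (hP : P * P ≤ span {(q : R)}) (hPq : absNorm P = q ^ 2) (k : ℕ) :
    Nat.card {I : Ideal R // absNorm I = q ^ k} = if Even k then 1 else 0 := by
  have key {I : Ideal R} (hI : absNorm I = q ^ k) : ∃ i, k = i + i ∧ I = P ^ i := by
    obtain ⟨i, j, rfl⟩ := exists_eq_pow_mul_pow hq hP hI
    rw [← pow_add, map_pow, hPq, ← pow_mul] at hI
    have := Nat.pow_right_injective hq.two_le hI
    exact ⟨i + j, by omega, (pow_add _ _ _).symm⟩
  split_ifs with hk
  · obtain ⟨i, rfl⟩ := hk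
    rw [Nat.card_eq_one_iff_exists]
    refine ⟨⟨P ^ i, by rw [map_pow, hPq]; ring⟩, fun ⟨I, hI⟩ ↦ Subtype.ext ?_⟩
    obtain ⟨j, hj, rfl⟩ := key hI
    exact congrArg (P ^ ·) (by omega : j = i)
  · have : IsEmpty {I : Ideal R // absNorm I = q ^ k} :=
      ⟨fun ⟨I, hI⟩ ↦ let ⟨i, hi, _⟩ := key hI; hk ⟨i, hi⟩⟩
    exact Nat.card_of_isEmpty

lemma card_absNorm_eq_of_ramified {P : Ideal R} [P.IsMaximal] {q : ℕ} (hq : q.Prime)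
    (hP : P * P ≤ span {(q : R)}) (hPq : absNorm P = q) (k : ℕ) :
    Nat.card {I : Ideal R // absNorm I = q ^ k} = 1 := by
  rw [Nat.card_eq_one_iff_exists]
  refine ⟨⟨P ^ k, by rw [map_pow, hPq]⟩, fun ⟨I, hI⟩ ↦ Subtype.ext ?_⟩
  obtain ⟨i, j, rfl⟩ := exists_eq_pow_mul_pow hq hP hI
  rw [← pow_add, map_pow, hPq] at hI
  exact (pow_add P i j).symm.trans (congrArg (P ^ ·) (Nat.pow_right_injective hq.two_le hI))

lemma card_absNorm_eq_of_split {P Q : Ideal R} [P.IsMaximal] [Q.IsMaximal] (hne : P ≠ Q) {q : ℕ}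
    (hq : q.Prime) (hPQ : P * Q ≤ span {(q : R)}) (hPq : absNorm P = q) (hQq : absNorm Q = q)
    (k : ℕ) : Nat.card {I : Ideal R // absNorm I = q ^ k} = k + 1 := by
  have hP0 : P ≠ ⊥ := fun h ↦ hq.ne_zero (by rw [← hPq, h, absNorm_bot])
  rw [← Finset.Nat.card_antidiagonal k, ← Nat.card_eq_finsetCard]
  refine (Nat.card_congr (Equiv.ofBijective
    (fun x ↦ ⟨P ^ x.1.1 * Q ^ x.1.2, by
      rw [map_mul, map_pow, map_pow, hPq, hQq, ← pow_add, Finset.HasAntidiagonal.mem_antidiagonal.1 x.2]⟩)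
    ⟨?_, ?_⟩)).symm
  · rintro ⟨⟨i, j⟩, hij⟩ ⟨⟨i', j'⟩, hij'⟩ h
    have h' : P ^ i * Q ^ j = P ^ i' * Q ^ j' := congrArg Subtype.val h
    have h1 := le_of_pow_mul_pow_eq hne hP0 h'
    have h2 := le_of_pow_mul_pow_eq hne hP0 h'.symm
    simp only [Finset.HasAntidiagonal.mem_antidiagonal] at hij hij'
    simp only [Subtype.mk.injEq, Prod.mk.injEq]
    omega
  · rintro ⟨I, hI⟩
    obtain ⟨i, j, rfl⟩ := exists_eq_pow_mul_pow hq hPQ hI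
    rw [map_mul, map_pow, map_pow, hPq, hQq, ← pow_add] at hI
    exact ⟨⟨(i, j), Finset.HasAntidiagonal.mem_antidiagonal.2 (Nat.pow_right_injective hq.two_le hI)⟩, rfl⟩

end IdealCount

section QuadraticPrimes

open NumberField Ideal

lemma legendreSym_neg_eq {p q : ℕ} [Fact p.Prime] [Fact q.Prime] (hp4 : p % 4 = 3) (hq : q ≠ 2) :
    legendreSym q (-p) = legendreSym p q := by
  rw [← neg_one_mul, legendreSym.mul, legendreSym.at_neg_one hq, ZMod.χ₄_nat_eq_if_mod_four]
  have hq2 : q % 2 = 1 := (Nat.Prime.mod_two_eq_one_iff_ne_two Fact.out).2 hq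
  rw [if_neg (by omega)]
  split_ifs with h
  · rw [one_mul, legendreSym.quadratic_reciprocity_one_mod_four h (by omega)]
  · rw [legendreSym.quadratic_reciprocity_three_mod_four hp4 (by omega), neg_one_mul, neg_neg]

lemma exists_dvd_iff_legendreSym_eq_one {p q : ℕ} [Fact p.Prime] [Fact q.Prime] (hp4 : p % 4 = 3)
    (hqp : q ≠ p) :
    (∃ a : ℤ, (q : ℤ) ∣ a ^ 2 - a + ((p + 1) / 4 : ℕ)) ↔ legendreSym p q = 1 := by
  obtain ⟨c, hc⟩ : ∃ c : ℕ, p + 1 = 4 * c := ⟨(p + 1) / 4, by omega⟩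
  rw [hc, Nat.mul_div_cancel_left _ four_pos]
  rcases eq_or_ne q 2 with rfl | hq
  · have h1 : (∃ a : ℤ, ((2 : ℕ) : ℤ) ∣ a ^ 2 - a + c) ↔ p % 8 = 7 := by
      have heven (a : ℤ) : Even (a ^ 2 - a) := by
        rw [pow_two, ← mul_sub_one]
        exact Int.even_mul_pred_self a
      constructor
      · rintro ⟨a, ha⟩
        obtain ⟨b, hb⟩ := heven a
        rw [hb] at ha
        omega
      · intro h
        exact ⟨0, by norm_num; omega⟩
    rw [h1, Nat.cast_ofNat, legendreSym.at_two (by omega), ZMod.χ₈_nat_eq_if_mod_eight]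
    constructor
    · intro h
      rw [if_neg (by omega), if_pos (by omega)]
    · intro h
      split_ifs at h <;> omega
  · have hq0 : (q : ZMod p) ≠ 0 := by
      rw [Ne, CharP.cast_eq_zero_iff (ZMod p) p, Nat.prime_dvd_prime_iff_eq Fact.out Fact.out]
      exact hqp.symm
    have hp0 : (p : ZMod q) ≠ 0 := by
      rw [Ne, CharP.cast_eq_zero_iff (ZMod q) q, Nat.prime_dvd_prime_iff_eq Fact.out Fact.out]
      exact hqp
    have h2 : (2 : ZMod q) ≠ 0 := by
      have : ((2 : ℕ) : ZMod q) ≠ 0 := by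
        rw [Ne, CharP.cast_eq_zero_iff (ZMod q) q, Nat.prime_dvd_prime_iff_eq Fact.out Nat.prime_two]
        exact hq
      exact_mod_cast this
    have hc' : (p : ZMod q) + 1 = 4 * c := by exact_mod_cast congrArg (Nat.cast : ℕ → ZMod q) hc
    rw [← legendreSym_neg_eq hp4 hq, legendreSym.eq_one_iff q (by simpa using hp0)]
    push_cast
    constructor
    · rintro ⟨a, ha⟩
      rw [← ZMod.intCast_zmod_eq_zero_iff_dvd] at ha
      push_cast at ha
      exact ⟨2 * a - 1, by linear_combination (-4) * ha - hc'⟩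
    · rintro ⟨y, hy⟩
      obtain ⟨a, ha⟩ := ZMod.intCast_surjective ((y + 1) / 2)
      refine ⟨a, ?_⟩
      rw [← ZMod.intCast_zmod_eq_zero_iff_dvd]
      push_cast
      have h4 : (4 : ZMod q) ≠ 0 := by
        rw [show (4 : ZMod q) = 2 * 2 by norm_num]
        exact mul_ne_zero h2 h2
      refine mul_left_cancel₀ h4 ?_
      have ha2 : 2 * (a : ZMod q) = y + 1 := by rw [ha]; field_simp
      linear_combination (2 * a + y - 1 : ZMod q) * ha2 - hy - hc'

variable {p q : ℕ} {K : Type*} [Field K] [NumberField K] {θ : 𝓞 K}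

lemma intCast_mem_iff_dvd {R : Type*} [CommRing R] {q : ℕ} (hq : q.Prime) {M : Ideal R}
    (hM : M ≠ ⊤) (hqM : (q : R) ∈ M) {a : ℤ} : (a : R) ∈ M ↔ (q : ℤ) ∣ a := by
  refine ⟨fun ha ↦ ?_, fun ⟨b, hb⟩ ↦ ?_⟩
  · by_contra h
    obtain ⟨u, v, huv⟩ := (Nat.prime_iff_prime_int.1 hq).coprime_iff_not_dvd.2 h
    refine hM ((eq_top_iff_one _).2 ?_)
    have : (1 : R) = u * q + v * a := by exact_mod_cast congrArg (Int.cast : ℤ → R) huv.symm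
    rw [this]
    exact M.add_mem (M.mul_mem_left _ hqM) (M.mul_mem_left _ ha)
  · rw [hb]
    push_cast
    exact M.mul_mem_right _ hqM

lemma sub_intCast_notMem_span (hp4 : p % 4 = 3) (hq : q.Prime)
    (hθ : θ ^ 2 = θ - ((p + 1) / 4 : ℕ)) (hspan : ∀ x : 𝓞 K, ∃ a b : ℤ, x = a + b * θ) (a : ℤ) :
    θ - a ∉ span {(q : 𝓞 K)} := by
  intro h
  obtain ⟨x, hx⟩ := mem_span_singleton.1 h
  obtain ⟨u, v, rfl⟩ := hspan x
  have := (int_eq_zero_of_add_mul_eq_zero hp4 hθ (a := -a - q * u) (b := 1 - q * v) (by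
    push_cast
    linear_combination hx)).2
  have h1 : (q : ℤ) ∣ 1 := ⟨v, by linarith⟩
  exact (Nat.prime_iff_prime_int.1 hq).not_dvd_one h1

/-- The candidates for the prime ideals above `q`. -/
def quadraticPrime (q : ℕ) (θ : 𝓞 K) (a : ℤ) : Ideal (𝓞 K) := span {(q : 𝓞 K), θ - a}

lemma quadraticPrime_mul_le (hθ : θ ^ 2 = θ - ((p + 1) / 4 : ℕ)) {a : ℤ}
    (ha : (q : ℤ) ∣ a ^ 2 - a + ((p + 1) / 4 : ℕ)) :
    quadraticPrime q θ a * quadraticPrime q θ (1 - a) ≤ span {(q : 𝓞 K)} := by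
  rw [quadraticPrime, quadraticPrime, span_pair_mul_span_pair, span_le]
  generalize (p + 1) / 4 = c at hθ ha
  obtain ⟨b, hb⟩ := ha
  have hb' : (a : 𝓞 K) ^ 2 - a + c = q * b := by
    exact_mod_cast congrArg (Int.cast : ℤ → 𝓞 K) hb
  rintro x (rfl | rfl | rfl | rfl) <;> rw [SetLike.mem_coe, mem_span_singleton]
  · exact dvd_mul_right _ _
  · exact dvd_mul_right _ _
  · exact dvd_mul_left _ _
  · refine ⟨-b, ?_⟩
    push_cast
    linear_combination hθ - hb'

lemma quadraticPrime_ne_top (hp4 : p % 4 = 3) (hq : q.Prime)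
    (hθ : θ ^ 2 = θ - ((p + 1) / 4 : ℕ)) (hspan : ∀ x : 𝓞 K, ∃ a b : ℤ, x = a + b * θ) {a : ℤ}
    (ha : (q : ℤ) ∣ a ^ 2 - a + ((p + 1) / 4 : ℕ)) : quadraticPrime q θ a ≠ ⊤ := by
  intro h
  have h1 := quadraticPrime_mul_le hθ ha
  rw [h, top_mul] at h1
  exact sub_intCast_notMem_span hp4 hq hθ hspan (1 - a)
    (h1 (subset_span (Set.mem_insert_of_mem _ rfl)))

lemma absNorm_span_natCast_eq_sq (hp4 : p % 4 = 3) (hθ : θ ^ 2 = θ - ((p + 1) / 4 : ℕ))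
    (hspan : ∀ x : 𝓞 K, ∃ a b : ℤ, x = a + b * θ) (q : ℕ) :
    absNorm (span {(q : 𝓞 K)}) = q ^ 2 := by
  rw [absNorm_span_natCast, RingOfIntegers.rank, finrank_eq_two hp4 hθ hspan]

lemma absNorm_eq_or_eq_span (hp4 : p % 4 = 3) (hq : q.Prime)
    (hθ : θ ^ 2 = θ - ((p + 1) / 4 : ℕ)) (hspan : ∀ x : 𝓞 K, ∃ a b : ℤ, x = a + b * θ)
    {M : Ideal (𝓞 K)} (hM : M ≠ ⊤) (hqM : (q : 𝓞 K) ∈ M) :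
    absNorm M = q ∨ M = span {(q : 𝓞 K)} := by
  have hle : span {(q : 𝓞 K)} ≤ M := (span_singleton_le_iff_mem _).2 hqM
  have h1 := absNorm_dvd_absNorm_of_le hle
  rw [absNorm_span_natCast_eq_sq hp4 hθ hspan] at h1
  obtain ⟨k, hk, hMk⟩ := (Nat.dvd_prime_pow hq).1 h1
  interval_cases k
  · exact absurd (absNorm_eq_one_iff.1 (by simpa using hMk)) hM
  · exact .inl (by simpa using hMk)
  · refine .inr (eq_of_le_of_absNorm_eq hle ?_ ?_).symm
    · rw [hMk, absNorm_span_natCast_eq_sq hp4 hθ hspan]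
    · rw [hMk]
      exact pow_ne_zero 2 hq.ne_zero

lemma absNorm_quadraticPrime (hp4 : p % 4 = 3) (hq : q.Prime)
    (hθ : θ ^ 2 = θ - ((p + 1) / 4 : ℕ)) (hspan : ∀ x : 𝓞 K, ∃ a b : ℤ, x = a + b * θ) {a : ℤ}
    (ha : (q : ℤ) ∣ a ^ 2 - a + ((p + 1) / 4 : ℕ)) : absNorm (quadraticPrime q θ a) = q := by
  refine (absNorm_eq_or_eq_span hp4 hq hθ hspan (quadraticPrime_ne_top hp4 hq hθ hspan ha)
    (subset_span (Set.mem_insert _ _))).resolve_right fun h ↦ ?_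
  refine sub_intCast_notMem_span hp4 hq hθ hspan a ?_
  rw [← h]
  exact subset_span (Set.mem_insert_of_mem _ rfl)

lemma isMaximal_of_prime_absNorm {I : Ideal (𝓞 K)} (hq : q.Prime) (hI : absNorm I = q) :
    I.IsMaximal :=
  (isPrime_of_irreducible_absNorm (hI ▸ hq)).isMaximal fun h ↦ hq.ne_zero (by
    rw [← hI, h, absNorm_bot])

lemma isMaximal_span_of_not_exists_dvd (hp4 : p % 4 = 3) (hq : q.Prime)
    (hθ : θ ^ 2 = θ - ((p + 1) / 4 : ℕ)) (hspan : ∀ x : 𝓞 K, ∃ a b : ℤ, x = a + b * θ)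
    (h : ¬ ∃ a : ℤ, (q : ℤ) ∣ a ^ 2 - a + ((p + 1) / 4 : ℕ)) :
    (span {(q : 𝓞 K)}).IsMaximal := by
  have htop : span {(q : 𝓞 K)} ≠ ⊤ := by
    rw [Ne, ← absNorm_eq_one_iff, absNorm_span_natCast_eq_sq hp4 hθ hspan]
    exact (Nat.one_lt_pow two_ne_zero hq.one_lt).ne'
  obtain ⟨M, hM, hle⟩ := exists_le_maximal _ htop
  have hqM : (q : 𝓞 K) ∈ M := (span_singleton_le_iff_mem _).1 hle
  rcases absNorm_eq_or_eq_span hp4 hq hθ hspan hM.ne_top hqM with hn | hn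
  · have hfin : Finite (𝓞 K ⧸ M) := (absNorm_ne_zero_iff M).1 (hn ▸ hq.ne_zero)
    have := Fintype.ofFinite (𝓞 K ⧸ M)
    have hcard : Fintype.card (𝓞 K ⧸ M) = q := by
      rw [← Nat.card_eq_fintype_card, ← hn]
      rfl
    let e := ZMod.ringEquivOfPrime (𝓞 K ⧸ M) hq hcard
    obtain ⟨y, hy⟩ := e.surjective (Ideal.Quotient.mk M θ)
    obtain ⟨a, rfl⟩ := ZMod.intCast_surjective y
    rw [map_intCast, ← map_intCast (Ideal.Quotient.mk M)] at hy
    refine absurd ⟨a, (intCast_mem_iff_dvd hq hM.ne_top hqM).1 ?_⟩ h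
    generalize (p + 1) / 4 = c at hθ
    rw [← Ideal.Quotient.eq_zero_iff_mem]
    push_cast
    rw [map_add, map_sub, map_pow, hy, ← map_pow, hθ]
    simp
  · exact hn ▸ hM

lemma quadraticPrime_eq_iff (hp4 : p % 4 = 3) (hq : q.Prime)
    (hθ : θ ^ 2 = θ - ((p + 1) / 4 : ℕ)) (hspan : ∀ x : 𝓞 K, ∃ a b : ℤ, x = a + b * θ) {a : ℤ}
    (ha : (q : ℤ) ∣ a ^ 2 - a + ((p + 1) / 4 : ℕ)) :
    quadraticPrime q θ a = quadraticPrime q θ (1 - a) ↔ q ∣ p := by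
  have hq' := Nat.prime_iff_prime_int.1 hq
  have hdvd : q ∣ p ↔ (q : ℤ) ∣ 2 * a - 1 := by
    have h1 : (2 * a - 1) ^ 2 = 4 * (a ^ 2 - a + ((p + 1) / 4 : ℕ)) - p := by
      have : (p : ℤ) + 1 = 4 * ((p + 1) / 4 : ℕ) := by omega
      linear_combination this
    rw [← hq'.dvd_pow_iff_dvd two_ne_zero, h1, dvd_sub_right (ha.mul_left 4), Int.natCast_dvd_natCast]
  rw [hdvd]
  have hsub : ((2 * a - 1 : ℤ) : 𝓞 K) = (θ - (1 - a : ℤ)) - (θ - a) := by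
    push_cast
    ring
  refine ⟨fun h ↦ ?_, fun ⟨b, hb⟩ ↦ ?_⟩
  · rw [← intCast_mem_iff_dvd hq (quadraticPrime_ne_top hp4 hq hθ hspan ha)
      (subset_span (Set.mem_insert _ _)), hsub]
    refine sub_mem ?_ (subset_span (Set.mem_insert_of_mem _ rfl))
    rw [h]
    exact subset_span (Set.mem_insert_of_mem _ rfl)
  · rw [hb] at hsub
    push_cast at hsub
    have h1 : θ - (1 - a : ℤ) = θ - a + q * b := by
      push_cast
      linear_combination -hsub
    rw [quadraticPrime, quadraticPrime, h1, span_pair_add_left_mul]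

lemma legendreChar_natCast (p : ℕ) [Fact p.Prime] (n : ℕ) :
    legendreChar p n = (legendreSym p n : ℂ) := by
  simp [legendreSym]

lemma zetaMul_prime_pow {N : ℕ} [NeZero N] (χ : DirichletCharacter ℂ N) (hq : q.Prime) (k : ℕ) :
    χ.zetaMul (q ^ k) = ∑ i ∈ Finset.range (k + 1), χ q ^ i := by
  rw [DirichletCharacter.zetaMul, ArithmeticFunction.coe_zeta_mul_apply, Nat.sum_divisors_prime_pow hq]
  refine Finset.sum_congr rfl fun i _ ↦ ?_
  simp [toArithmeticFunction, hq.ne_zero]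

lemma idealCount_eq_zetaMul [Fact p.Prime] (hp4 : p % 4 = 3)
    (hθ : θ ^ 2 = θ - ((p + 1) / 4 : ℕ)) (hspan : ∀ x : 𝓞 K, ∃ a b : ℤ, x = a + b * θ) :
    idealCount (𝓞 K) = (legendreChar p).zetaMul := by
  rw [ArithmeticFunction.IsMultiplicative.eq_iff_eq_on_prime_powers _ isMultiplicative_idealCount _
    (legendreChar p).isMultiplicative_zetaMul]
  intro q k hq
  have : Fact q.Prime := ⟨hq⟩
  rw [idealCount_apply (pow_ne_zero k hq.ne_zero), zetaMul_prime_pow _ hq, legendreChar_natCast]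
  by_cases hroot : ∃ a : ℤ, (q : ℤ) ∣ a ^ 2 - a + ((p + 1) / 4 : ℕ)
  · obtain ⟨a, ha⟩ := hroot
    have hb : (q : ℤ) ∣ (1 - a) ^ 2 - (1 - a) + ((p + 1) / 4 : ℕ) := by
      convert ha using 1
      ring
    have hPa := absNorm_quadraticPrime hp4 hq hθ hspan ha
    have hPb := absNorm_quadraticPrime hp4 hq hθ hspan hb
    have := isMaximal_of_prime_absNorm hq hPa
    have := isMaximal_of_prime_absNorm hq hPb
    have hle := quadraticPrime_mul_le hθ ha
    have heq := quadraticPrime_eq_iff hp4 hq hθ hspan ha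
    rw [Nat.prime_dvd_prime_iff_eq hq Fact.out] at heq
    by_cases hqp : q = p
    · rw [← heq.2 hqp] at hle
      rw [card_absNorm_eq_of_ramified hq hle hPa, hqp]
      have : legendreSym p p = 0 := by simp [legendreSym]
      simp [this, Finset.sum_range_succ']
    · rw [card_absNorm_eq_of_split (heq.not.2 hqp) hq hle hPa hPb,
        (exists_dvd_iff_legendreSym_eq_one hp4 hqp).1 ⟨a, ha⟩]
      simp
  · have := isMaximal_span_of_not_exists_dvd hp4 hq hθ hspan hroot
    have hqp : q ≠ p := by
      rintro rfl
      refine hroot ⟨2 * ((q + 1) / 4 : ℕ), ((q + 1) / 4 : ℕ), ?_⟩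
      have : (q : ℤ) = 4 * ((q + 1) / 4 : ℕ) - 1 := by omega
      linear_combination (-((q + 1) / 4 : ℕ) : ℤ) * this
    have hq0 : ((q : ℤ) : ZMod p) ≠ 0 := by
      rw [Int.cast_natCast, Ne, CharP.cast_eq_zero_iff (ZMod p) p,
        Nat.prime_dvd_prime_iff_eq Fact.out hq]
      exact hqp.symm
    rw [card_absNorm_eq_of_inert hq mul_le_right (absNorm_span_natCast_eq_sq hp4 hθ hspan q),
      (legendreSym.eq_one_or_neg_one p hq0).resolve_left
        ((exists_dvd_iff_legendreSym_eq_one hp4 hqp).not.1 hroot)]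
    push_cast
    rw [neg_one_geom_sum]
    simp only [Nat.even_add_one, ite_not]

end QuadraticPrimes

lemma LFunction_legendreChar_zero_eq_classNumber (p : ℕ) [Fact p.Prime] (hp4 : p % 4 = 3)
    (hp : 3 < p) (K : Type*) [Field K] [NumberField K] (α : K) (hα : α ^ 2 = -(p : K))
    (hgen : Algebra.adjoin ℚ ({α} : Set K) = ⊤) :
    DirichletCharacter.LFunction (legendreChar p) 0 = (NumberField.classNumber K : ℂ) := by
  obtain ⟨θ, hθ, hspan⟩ := exists_integral_generator hp4 hα hgen
  rw [LFunction_legendreChar_zero p hp4,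
    LFunction_one_eq_dedekindZeta_residue (K := K) (legendreChar_ne_one p (by omega)) fun n hn ↦ by
      rw [← idealCount_eq_zetaMul hp4 hθ hspan, idealCount_apply hn],
    dedekindZeta_residue_eq hp4 hp hθ hspan, ← Complex.ofReal_mul]
  have h1 : √(p : ℝ) ≠ 0 := (Real.sqrt_pos.2 (Nat.cast_pos.2 (by omega))).ne'
  have h2 := Real.pi_ne_zero
  rw [← Complex.ofReal_natCast]
  congr 1
  field_simp

section Derivative

open Complex

lemma hasDerivAt_LFunction_zero {N : ℕ} [NeZero N] {χ : DirichletCharacter ℂ N} (hχ : χ ≠ 1)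
    (hN : N ≠ 1) :
    HasDerivAt (DirichletCharacter.LFunction χ)
      (∑ j : ZMod N, χ j * (Real.log (Real.Gamma ((j.val : ℝ) / N)) : ℂ) -
        DirichletCharacter.LFunction χ 0 * (Real.log N : ℂ)) 0 := by
  have hN0 : (N : ℂ) ≠ 0 := Nat.cast_ne_zero.2 (NeZero.ne N)
  have hsum (s : ℂ) : ∑ j : ZMod N, χ j * HurwitzZeta.hurwitzZeta (ZMod.toAddCircle j) s =
      ∑ j : ZMod N, χ j * (HurwitzZeta.hurwitzZeta (ZMod.toAddCircle j) s -
        HurwitzZeta.hurwitzZeta 0 s) := by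
    simp_rw [mul_sub, Finset.sum_sub_distrib, ← Finset.sum_mul, χ.sum_eq_zero_of_ne_one hχ,
      zero_mul, sub_zero]
  have hL : DirichletCharacter.LFunction χ = fun s ↦ (N : ℂ) ^ (-s) *
      ∑ j : ZMod N, χ j * (HurwitzZeta.hurwitzZeta (ZMod.toAddCircle j) s -
        HurwitzZeta.hurwitzZeta 0 s) := by
    ext s
    rw [← hsum]
    rfl
  have h1 : HasDerivAt (fun s ↦ ∑ j : ZMod N, χ j *
      (HurwitzZeta.hurwitzZeta (ZMod.toAddCircle j) s - HurwitzZeta.hurwitzZeta 0 s))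
      (∑ j : ZMod N, χ j * (Real.log (Real.Gamma ((j.val : ℝ) / N)) : ℂ)) 0 := by
    refine HasDerivAt.fun_sum fun j _ ↦ ?_
    rcases eq_or_ne j 0 with rfl | hj
    · have := χ.map_zero' hN
      simpa [this] using hasDerivAt_const (0 : ℂ) (0 : ℂ)
    · have hj0 : (0 : ℝ) < (j.val : ℝ) / N := by
        have : 0 < j.val := Nat.pos_of_ne_zero (by simpa using hj)
        have := NeZero.pos N
        positivity
      have hj1 : (j.val : ℝ) / N ≤ 1 :=
        div_le_one_of_le₀ (by exact_mod_cast (ZMod.val_lt j).le) (Nat.cast_nonneg _)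
      rw [ZMod.toAddCircle_apply]
      exact (hasDerivAt_hurwitzZeta_sub_zero hj0 hj1).const_mul _
  have h2 : HasDerivAt (fun s : ℂ ↦ (N : ℂ) ^ (-s)) (-(Real.log N : ℂ)) 0 := by
    have := (hasDerivAt_neg (0 : ℂ)).const_cpow (c := (N : ℂ)) (.inl hN0)
    simpa [ofReal_log (Nat.cast_nonneg N)] using this
  have h0 : DirichletCharacter.LFunction χ 0 = ∑ j : ZMod N, χ j *
      (HurwitzZeta.hurwitzZeta (ZMod.toAddCircle j) 0 - HurwitzZeta.hurwitzZeta 0 0) := by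
    simp [hL]
  rw [h0, hL]
  refine (h2.fun_mul h1).congr_deriv ?_
  rw [neg_zero, cpow_zero]
  ring

lemma sum_legendreChar_mul (p : ℕ) [Fact p.Prime] (f : ℕ → ℂ) :
    ∑ j : ZMod p, legendreChar p j * f j.val =
      ∑ a ∈ Finset.Icc 1 (p - 1), (legendreSym p a : ℂ) * f a := by
  have hp : 0 < p := NeZero.pos p
  have h1 : ∑ a ∈ Finset.range p, (legendreSym p a : ℂ) * f a =
      ∑ j : ZMod p, legendreChar p j * f j.val := by
    refine Finset.sum_bij' (fun a _ ↦ (a : ZMod p)) (fun j _ ↦ j.val) (by simp)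
      (fun j _ ↦ by simpa using ZMod.val_lt j)
      (fun a ha ↦ ZMod.val_cast_of_lt (Finset.mem_range.1 ha)) (by simp) fun a ha ↦ ?_
    rw [ZMod.val_cast_of_lt (Finset.mem_range.1 ha)]
    simp [legendreSym]
  rw [← h1, Finset.range_eq_Ico, Finset.sum_eq_sum_Ico_succ_bot hp]
  have : Finset.Ico (0 + 1) p = Finset.Icc 1 (p - 1) := by ext; simp; omega
  simp [this, legendreSym]

end Derivative

theorem deriv_LFunction_legendre_zero (p : ℕ) [Fact p.Prime]
    (hp4 : p % 4 = 3) (hp : 3 < p)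
    (K : Type) [Field K] [NumberField K] (α : K)
    (hα : α ^ 2 = -(p : K)) (hgen : Algebra.adjoin ℚ ({α} : Set K) = ⊤) :
    deriv (DirichletCharacter.LFunction
        ((quadraticChar (ZMod p)).ringHomComp (Int.castRingHom ℂ))) 0
      = (∑ a ∈ Finset.Icc 1 (p - 1),
            (legendreSym p a : ℂ) * (Real.log (Real.Gamma ((a : ℝ) / p)) : ℂ))
          - (NumberField.classNumber K : ℂ) * (Real.log p : ℂ) ∧
    DirichletCharacter.LFunction
        ((quadraticChar (ZMod p)).ringHomComp (Int.castRingHom ℂ)) 0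
      = (NumberField.classNumber K : ℂ) ∧
    deriv (DirichletCharacter.LFunction
          ((quadraticChar (ZMod p)).ringHomComp (Int.castRingHom ℂ))) 0
        / DirichletCharacter.LFunction
            ((quadraticChar (ZMod p)).ringHomComp (Int.castRingHom ℂ)) 0
      = (1 / (NumberField.classNumber K : ℂ)) *
          (∑ a ∈ Finset.Icc 1 (p - 1),
            (legendreSym p a : ℂ) * (Real.log (Real.Gamma ((a : ℝ) / p)) : ℂ))
        - (Real.log p : ℂ) := by
  have h0 := LFunction_legendreChar_zero_eq_classNumber p hp4 hp K α hα hgen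
  have h1 := (hasDerivAt_LFunction_zero (legendreChar_ne_one p (by omega)) (by omega)).deriv
  rw [h0, sum_legendreChar_mul p (fun a ↦ (Real.log (Real.Gamma ((a : ℝ) / p)) : ℂ))] at h1
  have hh : (NumberField.classNumber K : ℂ) ≠ 0 :=
    Nat.cast_ne_zero.2 (NumberField.classNumber_ne_zero K)
  refine ⟨h1, h0, ?_⟩
  rw [h1, h0]
  field_simp
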